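/- arXiv:1902.03215 — 6 statements merged into one kernel-verified Lean document; each statement's English description precedes it below -/
import Mathlib

section
/- Let T be an invertible measure-preserving transformation of a σ-finite measure space (X,μ), let A₀, B₀ be measurable sets of finite measure, and let h, n be integers. Assume A = A₀ ∪ T^hA₀ and B = B₀ ∪ T^hB₀ with A₀ ∩ T^hA₀ = ∅ and B₀ ∩ T^hB₀ = ∅, and assume μ(T^nA₀ ∩ B₀) = 0, μ(T^{n+h}A₀ ∩ B₀) = 0, and μ(T^{n−2h}A₀ ∩ B₀) = 0. Then μ(T^nA ∩ B) = (1/2)·μ(T^{n−h}A ∩ B). -/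
open MeasureTheory Filter Topology Set
open scoped ENNReal

namespace Equiv.Perm

variable {X : Type*} {T : Equiv.Perm X}

theorem image_zpow_image_zpow (j k : ℤ) (S : Set X) :
    ⇑(T ^ j) '' (⇑(T ^ k) '' S) = ⇑(T ^ (j + k)) '' S := by
  rw [← image_comp, ← coe_mul, ← zpow_add]

theorem image_zpow_eq_preimage (k : ℤ) (S : Set X) :
    ⇑(T ^ k) '' S = ⇑(T ^ (-k)) ⁻¹' S := by
  rw [zpow_neg]
  exact (T ^ k).image_eq_preimage_symm S

variable [MeasurableSpace X] {μ : Measure X}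

theorem measurePreserving_zpow (hT' : Measurable (⇑T.symm))
    (hT : MeasurePreserving (⇑T) μ μ) (k : ℤ) : MeasurePreserving (⇑(T ^ k)) μ μ := by
  have hTinv : MeasurePreserving (⇑T⁻¹) μ μ :=
    hT.symm (⟨T, hT.measurable, hT'⟩ : X ≃ᵐ X)
  cases k with
  | ofNat m =>
    rw [Int.ofNat_eq_natCast, zpow_natCast, ← iterate_eq_pow]
    exact hT.iterate m
  | negSucc m =>
    rw [zpow_negSucc, ← inv_pow, ← iterate_eq_pow]
    exact hTinv.iterate (m + 1)

theorem measurableSet_image_zpow (hT' : Measurable (⇑T.symm))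
    (hT : MeasurePreserving (⇑T) μ μ) (k : ℤ) {S : Set X} (hS : MeasurableSet S) :
    MeasurableSet (⇑(T ^ k) '' S) := by
  rw [image_zpow_eq_preimage]
  exact (measurePreserving_zpow hT' hT (-k)).measurable hS

theorem measure_image_zpow (hT' : Measurable (⇑T.symm))
    (hT : MeasurePreserving (⇑T) μ μ) (k : ℤ) {S : Set X} (hS : MeasurableSet S) :
    μ (⇑(T ^ k) '' S) = μ S := by
  rw [image_zpow_eq_preimage]
  exact (measurePreserving_zpow hT' hT (-k)).measure_preimage hS.nullMeasurableSet

theorem measure_image_zpow_inter_image_zpow (hT' : Measurable (⇑T.symm))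
    (hT : MeasurePreserving (⇑T) μ μ) (j k : ℤ) {S R : Set X}
    (hS : MeasurableSet S) (hR : MeasurableSet R) :
    μ (⇑(T ^ j) '' S ∩ ⇑(T ^ k) '' R) = μ (⇑(T ^ (j - k)) '' S ∩ R) := by
  rw [← measure_image_zpow hT' hT k ((measurableSet_image_zpow hT' hT (j - k) hS).inter hR),
    image_inter (T ^ k).injective, image_zpow_image_zpow, add_sub_cancel]

/-- The measure of the intersection of a translate of a two-column set `S ⊔ T^h S` with a
two-column set `R ⊔ T^h R`, in terms of the correlations of the columns. -/
theorem measure_image_zpow_union_inter_union (hT' : Measurable (⇑T.symm))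
    (hT : MeasurePreserving (⇑T) μ μ) (h k : ℤ) {S R : Set X}
    (hS : MeasurableSet S) (hR : MeasurableSet R)
    (hSdisj : _root_.Disjoint S (⇑(T ^ h) '' S)) (hRdisj : _root_.Disjoint R (⇑(T ^ h) '' R)) :
    μ (⇑(T ^ k) '' (S ∪ ⇑(T ^ h) '' S) ∩ (R ∪ ⇑(T ^ h) '' R)) =
      (μ (⇑(T ^ k) '' S ∩ R) + μ (⇑(T ^ (k + h)) '' S ∩ R)) +
        (μ (⇑(T ^ (k - h)) '' S ∩ R) + μ (⇑(T ^ k) '' S ∩ R)) := by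
  have hm := fun (j : ℤ) {Q : Set X} (hQ : MeasurableSet Q) =>
    measurableSet_image_zpow hT' hT j hQ
  have hsplit (j : ℤ) : μ (⇑(T ^ j) '' (S ∪ ⇑(T ^ h) '' S) ∩ R) =
      μ (⇑(T ^ j) '' S ∩ R) + μ (⇑(T ^ (j + h)) '' S ∩ R) := by
    have hdisj := (disjoint_image_iff (T ^ j).injective).2 hSdisj
    rw [image_union, union_inter_distrib_right,
      measure_union (hdisj.mono inter_subset_left inter_subset_left)
        ((hm j (hm h hS)).inter hR), image_zpow_image_zpow]
  have hU := hS.union (hm h hS)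
  rw [inter_union_distrib_left,
    measure_union (hRdisj.mono inter_subset_right inter_subset_right)
      ((hm k hU).inter (hm h hR)),
    measure_image_zpow_inter_image_zpow hT' hT k h hU hR, hsplit, hsplit, sub_add_cancel]

end Equiv.Perm

/-- The halving identity: if `A = A₀ ⊔ T^h A₀`, `B = B₀ ⊔ T^h B₀` and the
intersections `T^n A₀ ∩ B₀`, `T^{n+h} A₀ ∩ B₀`, `T^{n-2h} A₀ ∩ B₀` are null,
then `μ(T^n A ∩ B) = (1/2) μ(T^{n-h} A ∩ B)`. -/
theorem halving_identity
    {X : Type*} [MeasurableSpace X] (μ : Measure X) [SigmaFinite μ]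
    (T : Equiv.Perm X) (hTmeas : Measurable (⇑T)) (hTmeas' : Measurable (⇑T.symm))
    (hT : MeasurePreserving ⇑T μ μ)
    (A₀ B₀ A B : Set X) (hA₀ : MeasurableSet A₀) (hB₀ : MeasurableSet B₀)
    (hA₀fin : μ A₀ < ∞) (hB₀fin : μ B₀ < ∞)
    (h n : ℤ)
    (hA : A = A₀ ∪ (⇑(T ^ h)) '' A₀) (hB : B = B₀ ∪ (⇑(T ^ h)) '' B₀)
    (hAdisj : Disjoint A₀ ((⇑(T ^ h)) '' A₀)) (hBdisj : Disjoint B₀ ((⇑(T ^ h)) '' B₀))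
    (h1 : μ ((⇑(T ^ n)) '' A₀ ∩ B₀) = 0)
    (h2 : μ ((⇑(T ^ (n + h))) '' A₀ ∩ B₀) = 0)
    (h3 : μ ((⇑(T ^ (n - 2 * h))) '' A₀ ∩ B₀) = 0) :
    μ ((⇑(T ^ n)) '' A ∩ B) = μ ((⇑(T ^ (n - h))) '' A ∩ B) / 2 := by
  rw [hA, hB, Equiv.Perm.measure_image_zpow_union_inter_union hTmeas' hT h n hA₀ hB₀ hAdisj hBdisj,
    Equiv.Perm.measure_image_zpow_union_inter_union hTmeas' hT h (n - h) hA₀ hB₀ hAdisj hBdisj,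
    sub_add_cancel, show n - h - h = n - 2 * h by ring, h1, h2, h3]
  simp only [zero_add, add_zero]
  rw [ENNReal.add_div, ENNReal.add_halves]
end

section
/- Let 0 < a < b. Let T be a two-column rank-one cutting-and-stacking transformation of (X,μ) with heights h_j and spacers s_j(2) satisfying s_j(2)/h_j → ∞, and let T′ be a two-column rank-one cutting-and-stacking transformation of (X′,μ′) with heights h′_j and spacers s′_j(2) satisfying s′_j(2)/h′_j → ∞, such that h_j/h′_j → a/b as j → ∞. Then the product T×T′ is a dissipative transformation of (X×X′, μ×μ′): there is a measurable set D ⊆ X×X′ such that the sets (T×T′)^iD, i∈ℤ, are pairwise disjoint and their union is conull. -/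
open MeasureTheory Filter Topology Set
open scoped ENNReal symmDiff

/-- The two-column rank-one cutting-and-stacking construction: at stage `j`
there is a tower `E_j, TE_j, …, T^{h_j-1}E_j` of pairwise disjoint levels; the
tower is cut in two, with no spacers over the first column and `s j` spacers
over the second, so `E_j = E_{j+1} ⊔ T^{h_j}E_{j+1}`, `μ(E_{j+1}) = μ(E_j)/2`
and `h_{j+1} = 2h_j + s j`; the levels cover `X` up to a null set, every set of
finite measure is approximated by unions of levels, and `μ(X) = ∞`. -/
structure TwoColumnCutStack {X : Type*} [MeasurableSpace X] (μ : Measure X)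
    (T : Equiv.Perm X) (E : ℕ → Set X) (h : ℕ → ℕ) (s : ℕ → ℕ) : Prop where
  measT : Measurable (⇑T)
  measTsymm : Measurable (⇑T.symm)
  mp : MeasurePreserving ⇑T μ μ
  infiniteMeasure : μ Set.univ = ∞
  measE : ∀ j, MeasurableSet (E j)
  hpos : ∀ j, 0 < h j
  disjLevels : ∀ j, ∀ i i' : ℕ, i < h j → i' < h j → i ≠ i' →
    Disjoint ((⇑(T ^ (i : ℤ))) '' E j) ((⇑(T ^ (i' : ℤ))) '' E j)
  cut : ∀ j, E j = E (j + 1) ∪ (⇑(T ^ (h j : ℤ))) '' E (j + 1)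
  cutDisj : ∀ j, Disjoint (E (j + 1)) ((⇑(T ^ (h j : ℤ))) '' E (j + 1))
  half : ∀ j, μ (E (j + 1)) = μ (E j) / 2
  height : ∀ j, h (j + 1) = 2 * h j + s j
  cover : μ ((⋃ j, ⋃ i ∈ Finset.range (h j), (⇑(T ^ (i : ℤ))) '' E j)ᶜ) = 0
  approx : ∀ A : Set X, MeasurableSet A → μ A < ∞ → ∀ ε : ℝ≥0∞, 0 < ε →
    ∀ᶠ j in atTop, ∃ I : Finset ℕ, (∀ i ∈ I, i < h j) ∧
      μ (symmDiff A (⋃ i ∈ I, (⇑(T ^ (i : ℤ))) '' E j)) < ε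
  spacerGrowth : Tendsto (fun j => (s j : ℝ) / (h j : ℝ)) atTop atTop

section Perm

variable {Y Z : Type*}

theorem Equiv.Perm.prodCongr_zpow_apply (S : Equiv.Perm Y) (S' : Equiv.Perm Z) (i : ℤ)
    (y : Y) (z : Z) :
    ((Equiv.prodCongr S S' : Equiv.Perm (Y × Z)) ^ i) (y, z) = ((S ^ i) y, (S' ^ i) z) := by
  induction i generalizing y z with
  | zero => rfl
  | succ i ih => simp only [zpow_add_one, Equiv.Perm.mul_apply, ← ih]; rfl
  | pred i ih => simp only [zpow_sub_one, Equiv.Perm.mul_apply, ← ih]; rfl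

theorem Equiv.Perm.measurable_zpow [MeasurableSpace Y] {S : Equiv.Perm Y} (hS : Measurable S)
    (hS' : Measurable S.symm) (i : ℤ) : Measurable (S ^ i : Equiv.Perm Y) := by
  induction i with
  | zero => exact measurable_id
  | succ i ih =>
    rw [zpow_add_one, Equiv.Perm.coe_mul]
    exact ih.comp hS
  | pred i ih =>
    rw [zpow_sub_one, Equiv.Perm.coe_mul]
    exact ih.comp hS'

theorem Equiv.Perm.measurableSet_zpow_image [MeasurableSpace Y] {S : Equiv.Perm Y}
    (hS : Measurable S) (hS' : Measurable S.symm) (i : ℤ) {A : Set Y} (hA : MeasurableSet A) :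
    MeasurableSet ((S ^ i : Equiv.Perm Y) '' A) := by
  rw [Equiv.image_eq_preimage_symm, ← Equiv.Perm.inv_def, ← zpow_neg]
  exact Equiv.Perm.measurable_zpow hS hS' (-i) hA

/-- A permutation under which each of countably many sets has bounded return times admits a
measurable wandering set whose orbit covers all of these sets. -/
theorem exists_wandering_of_bounded_returns [MeasurableSpace Y] {S : Equiv.Perm Y}
    (hS : Measurable S) (hS' : Measurable S.symm) {R : ℕ → Set Y}
    (hR : ∀ n, MeasurableSet (R n)) {N : ℤ}
    (hN : ∀ n, ∀ i : ℤ, N < i → ∀ x ∈ R n, (S ^ i) x ∉ R n) :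
    ∃ D : Set Y, MeasurableSet D ∧
      (∀ i i' : ℤ, i ≠ i' → Disjoint ((S ^ i : Equiv.Perm Y) '' D) ((S ^ i' : Equiv.Perm Y) '' D)) ∧
      ⋃ n, R n ⊆ ⋃ i : ℤ, (S ^ i : Equiv.Perm Y) '' D := by
  have hpre : ∀ n (i : ℤ), MeasurableSet {x | (S ^ i) x ∈ R n} := fun n i =>
    Equiv.Perm.measurable_zpow hS hS' i (hR n)
  refine ⟨{x | ∃ n, (x ∈ R n ∧ ∀ i : ℤ, 0 < i → (S ^ i) x ∉ R n) ∧
    ∀ m, m < n → ∀ i : ℤ, (S ^ i) x ∉ R m}, ?_, ?_, ?_⟩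
  · simp only [ofPred_exists, ofPred_and, ofPred_forall]
    exact MeasurableSet.iUnion fun n => ((hR n).inter
      (.iInter fun i => .iInter fun _ => (hpre n i).compl)).inter
      (.iInter fun m => .iInter fun _ => .iInter fun i => (hpre m i).compl)
  · intro i i' hi
    rw [Set.disjoint_left]
    rintro _ ⟨x, ⟨n, ⟨hx, hx'⟩, hn⟩, rfl⟩ ⟨y, ⟨m, ⟨hy, hy'⟩, hm⟩, hxy⟩
    have hyx : y = (S ^ (i - i')) x := by
      rw [sub_eq_neg_add, zpow_add, Equiv.Perm.mul_apply, ← hxy, ← Equiv.Perm.mul_apply,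
        ← zpow_add, neg_add_cancel, zpow_zero, Equiv.Perm.one_apply]
    have hxy' : x = (S ^ (i' - i)) y := by
      rw [hyx, ← Equiv.Perm.mul_apply, ← zpow_add, sub_add_sub_cancel, sub_self, zpow_zero,
        Equiv.Perm.one_apply]
    have hnm : n = m := by
      rcases lt_trichotomy n m with h | h | h
      · exact absurd (hxy' ▸ hx) (hm n h _)
      · exact h
      · exact absurd (hyx ▸ hy) (hn m h _)
    subst hnm
    rcases lt_or_gt_of_ne hi with h | h
    · exact hy' _ (sub_pos.2 h) (hxy' ▸ hx)
    · exact hx' _ (sub_pos.2 h) (hyx ▸ hy)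
  · intro x hx
    obtain ⟨k, hk⟩ := mem_iUnion.1 hx
    classical
    have hex : ∃ n, ∃ i : ℤ, (S ^ i) x ∈ R n := ⟨k, 0, hk⟩
    obtain ⟨i₀, hi₀⟩ := Nat.find_spec hex
    have hbdd : ∀ i : ℤ, (S ^ i) x ∈ R (Nat.find hex) → i ≤ N + i₀ := by
      intro i hi
      by_contra! hlt
      refine hN _ (i - i₀) (by lia) _ hi₀ ?_
      rwa [← Equiv.Perm.mul_apply, ← zpow_add, sub_add_cancel]
    obtain ⟨l, hl, hlmax⟩ := Int.exists_greatest_of_bdd ⟨_, hbdd⟩ ⟨i₀, hi₀⟩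
    refine mem_iUnion.2 ⟨-l, (S ^ l) x, ⟨Nat.find hex, ⟨hl, ?_⟩, ?_⟩, ?_⟩
    · intro i hi h
      rw [← Equiv.Perm.mul_apply, ← zpow_add] at h
      have := hlmax _ h
      lia
    · intro m hm i h
      rw [← Equiv.Perm.mul_apply, ← zpow_add] at h
      exact Nat.find_min hex hm ⟨_, h⟩
    · rw [← Equiv.Perm.mul_apply, ← zpow_add, neg_add_cancel, zpow_zero, Equiv.Perm.one_apply]

end Perm

namespace TwoColumnCutStack

variable {X : Type*} [MeasurableSpace X] {μ : Measure X} {T : Equiv.Perm X} {E : ℕ → Set X}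
  {h s : ℕ → ℕ}

theorem base_subset (hT : TwoColumnCutStack μ T E h s) (j : ℕ) : E j ⊆ E 0 := by
  induction j with
  | zero => exact subset_rfl
  | succ j ih => exact (hT.cut j ▸ subset_union_left : E (j + 1) ⊆ E j).trans ih

theorem height_mono (hT : TwoColumnCutStack μ T E h s) : Monotone h :=
  monotone_nat_of_le_succ fun j => by have := hT.height j; lia

theorem sum_height_le (hT : TwoColumnCutStack μ T E h s) (j : ℕ) :
    ∑ k ∈ Finset.range j, h k ≤ h j := by
  induction j with
  | zero => simp
  | succ j ih => rw [Finset.sum_range_succ, hT.height]; lia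

theorem lt_height (hT : TwoColumnCutStack μ T E h s) (j : ℕ) : j < h j := by
  induction j with
  | zero => exact hT.hpos 0
  | succ j ih => rw [hT.height]; lia

theorem eventually_mul_height_le (hT : TwoColumnCutStack μ T E h s) (K : ℝ) :
    ∀ᶠ j in atTop, K * h j ≤ h (j + 1) := by
  filter_upwards [hT.spacerGrowth.eventually_ge_atTop K] with j hj
  have hpos : (0 : ℝ) < h j := by exact_mod_cast hT.hpos j
  rw [le_div_iff₀ hpos] at hj
  rw [hT.height]
  push_cast
  linarith

theorem eventually_sum_height_le (hT : TwoColumnCutStack μ T E h s) {η : ℝ} (hη : 0 < η) :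
    ∀ᶠ j in atTop, ((∑ k ∈ Finset.range j, h k : ℕ) : ℝ) ≤ η * h j := by
  suffices ∀ᶠ j in atTop, ((∑ k ∈ Finset.range (j + 1), h k : ℕ) : ℝ) ≤ η * h (j + 1) by
    rwa [← map_add_atTop_eq_nat 1, eventually_map]
  filter_upwards [hT.eventually_mul_height_le (2 / η)] with j hj
  have hsum : ((∑ k ∈ Finset.range (j + 1), h k : ℕ) : ℝ) ≤ 2 * h j := by
    have := hT.sum_height_le j
    rw [Finset.sum_range_succ]
    exact_mod_cast (by lia : ∑ k ∈ Finset.range j, h k + h j ≤ 2 * h j)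
  calc ((∑ k ∈ Finset.range (j + 1), h k : ℕ) : ℝ) ≤ 2 * h j := hsum
    _ = η * (2 / η * h j) := by field_simp
    _ ≤ η * h (j + 1) := by gcongr

theorem return_succ (hT : TwoColumnCutStack μ T E h s) {j : ℕ} {i : ℤ} {x : X} (hx : x ∈ E j)
    (hix : (T ^ i) x ∈ E j) :
    ∃ c : ℤ, (c = -1 ∨ c = 0 ∨ c = 1) ∧ ∃ y ∈ E (j + 1), (T ^ (i - c * h j)) y ∈ E (j + 1) := by
  rw [hT.cut j] at hx hix
  rcases hx with hx | ⟨y, hy, rfl⟩ <;> rcases hix with hix | ⟨z, hz, hzx⟩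
  · exact ⟨0, by simp, x, hx, by simpa using hix⟩
  · refine ⟨1, by simp, x, hx, ?_⟩
    rwa [one_mul, sub_eq_neg_add, zpow_add, Equiv.Perm.mul_apply, ← hzx, ← Equiv.Perm.mul_apply,
      ← zpow_add, neg_add_cancel, zpow_zero, Equiv.Perm.one_apply]
  · refine ⟨-1, by simp, y, hy, ?_⟩
    rwa [neg_one_mul, sub_neg_eq_add, zpow_add, Equiv.Perm.mul_apply]
  · refine ⟨0, by simp, y, hy, ?_⟩
    rw [← Equiv.Perm.mul_apply, ← zpow_add, add_comm, zpow_add, Equiv.Perm.mul_apply] at hzx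
    rw [zero_mul, sub_zero, ← (T ^ (h j : ℤ)).injective hzx]
    exact hz

theorem return_eq_zero (hT : TwoColumnCutStack μ T E h s) {j : ℕ} {i : ℤ} {x : X} (hx : x ∈ E j)
    (hix : (T ^ i) x ∈ E j) (hi : |i| < h j) : i = 0 := by
  have key : ∀ (n : ℕ) (y : X), n < h j → y ∈ E j → (T ^ (n : ℤ)) y ∈ E j → n = 0 := by
    intro n y hn hy hny
    by_contra hn0
    exact Set.disjoint_left.1 (hT.disjLevels j n 0 hn (hT.hpos j) hn0) ⟨y, hy, rfl⟩
      ⟨_, hny, rfl⟩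
  obtain ⟨n, rfl | rfl⟩ := i.eq_nat_or_neg
  · exact_mod_cast key n x (by simpa using hi) hx hix
  · rw [key n ((T ^ (-n : ℤ)) x) (by simpa using hi) hix ?_]
    · simp
    · rwa [← Equiv.Perm.mul_apply, ← zpow_add, add_neg_cancel, zpow_zero, Equiv.Perm.one_apply]

/-- A nonzero return time to the base is a height up to the sum of the preceding heights. -/
theorem exists_abs_sub_height_le (hT : TwoColumnCutStack μ T E h s) {i : ℤ} {x : X}
    (hx : x ∈ E 0) (hix : (T ^ i) x ∈ E 0) (hi : i ≠ 0) :
    ∃ m, |(|i| - h m)| ≤ (∑ k ∈ Finset.range m, h k : ℕ) := by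
  have key : ∀ d, ∃ r : ℤ, (∃ y ∈ E d, (T ^ r) y ∈ E d) ∧
      |i - r| ≤ (∑ k ∈ Finset.range d, h k : ℕ) ∧
      (i - r = 0 ∨ ∃ m, |(|i - r| - h m)| ≤ (∑ k ∈ Finset.range m, h k : ℕ)) := by
    intro d
    induction d with
    | zero => exact ⟨i, ⟨x, hx, hix⟩, by simp, by simp⟩
    | succ d ih =>
      obtain ⟨r, ⟨y, hy, hry⟩, hle, hm⟩ := ih
      obtain ⟨c, hc, hr⟩ := hT.return_succ hy hry
      have hsum := Finset.sum_range_succ h d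
      refine ⟨_, hr, by rcases hc with rfl | rfl | rfl <;> grind, ?_⟩
      rcases hc with rfl | rfl | rfl
      · exact .inr ⟨d, by grind⟩
      · simpa using hm
      · exact .inr ⟨d, by grind⟩
  obtain ⟨d, hd, hid⟩ := ((hT.eventually_sum_height_le (half_pos one_pos)).and
    (eventually_ge_atTop (2 * i.natAbs))).exists
  obtain ⟨r, ⟨y, hy, hry⟩, hle, hm⟩ := key d
  have hd' : 2 * ∑ k ∈ Finset.range d, h k ≤ h d := by
    have : 2 * ((∑ k ∈ Finset.range d, h k : ℕ) : ℝ) ≤ h d := by linarith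
    exact_mod_cast this
  have hr : r = 0 := hT.return_eq_zero hy hry (by have := hT.lt_height d; grind)
  subst hr
  simpa [hi] using hm

theorem le_two_mul_height (hT : TwoColumnCutStack μ T E h s) {t : ℝ} {m : ℕ}
    (hm : |t - h m| ≤ (∑ k ∈ Finset.range m, h k : ℕ)) : t ≤ 2 * h m := by
  have : ((∑ k ∈ Finset.range m, h k : ℕ) : ℝ) ≤ h m := by exact_mod_cast hT.sum_height_le m
  linarith [(abs_le.1 hm).2]

theorem le_index (hT : TwoColumnCutStack μ T E h s) {t : ℝ} {m M : ℕ}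
    (hm : |t - h m| ≤ (∑ k ∈ Finset.range m, h k : ℕ)) (ht : 2 * h M < t) : M ≤ m := by
  by_contra! hlt
  have : (h m : ℝ) ≤ h M := by exact_mod_cast hT.height_mono hlt.le
  linarith [hT.le_two_mul_height hm]

variable {X' : Type*} [MeasurableSpace X'] {μ' : Measure X'} {T' : Equiv.Perm X'}
  {E' : ℕ → Set X'} {h' s' : ℕ → ℕ}

theorem measure_compl_iUnion_base (hT : TwoColumnCutStack μ T E h s) :
    μ (⋃ k : ℕ, (T ^ (k : ℤ) : Equiv.Perm X) '' E 0)ᶜ = 0 := by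
  refine measure_mono_null (compl_subset_compl.2 ?_) hT.cover
  refine iUnion_subset fun j => iUnion₂_subset fun k _ => ?_
  exact subset_iUnion_of_subset k (image_mono (hT.base_subset j))

/-- Common return times to the two bases are bounded when the ratio of heights converges to a
number strictly between `0` and `1`. -/
theorem exists_bound_common_return (hT : TwoColumnCutStack μ T E h s)
    (hT' : TwoColumnCutStack μ' T' E' h' s') {q : ℝ} (hq₀ : 0 < q) (hq₁ : q < 1)
    (hq : Tendsto (fun j => (h j : ℝ) / (h' j : ℝ)) atTop (𝓝 q)) :
    ∃ N : ℤ, ∀ i : ℤ, N < i → ∀ x ∈ E 0, (T ^ i) x ∈ E 0 → ∀ x' ∈ E' 0, (T' ^ i) x' ∉ E' 0 := by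
  obtain ⟨η, hη⟩ : ∃ η, η = (1 - q) / 8 := ⟨_, rfl⟩
  have hη₀ : 0 < η := by linarith
  have hη₁ : η < 1 / 8 := by linarith
  have hev := (hT.eventually_sum_height_le hη₀).and <| (hT'.eventually_sum_height_le hη₀).and <|
    (hT.eventually_mul_height_le (8 / q)).and <| (hT'.eventually_mul_height_le 4).and <|
    (hq.eventually_lt_const (show q < 1 - 4 * η by linarith)).and <|
    hq.eventually_const_lt (half_lt_self hq₀)
  obtain ⟨M, hM⟩ := eventually_atTop.1 hev
  refine ⟨2 * h M + 2 * h' M, fun i hi x hx hix x' hx' hix' => ?_⟩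
  have hi₀ : 0 < i := by lia
  obtain ⟨m, hm⟩ := hT.exists_abs_sub_height_le hx hix hi₀.ne'
  obtain ⟨m', hm'⟩ := hT'.exists_abs_sub_height_le hx' hix' hi₀.ne'
  rw [abs_of_pos hi₀] at hm hm'
  have hmR : |(i : ℝ) - h m| ≤ (∑ k ∈ Finset.range m, h k : ℕ) := by exact_mod_cast hm
  have hmR' : |(i : ℝ) - h' m'| ≤ (∑ k ∈ Finset.range m', h' k : ℕ) := by exact_mod_cast hm'
  have hiR : 2 * (h M : ℝ) + 2 * h' M < i := by exact_mod_cast hi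
  have hMm : M ≤ m := hT.le_index hmR (by linarith [(h' M).cast_nonneg (α := ℝ)])
  have hMm' : M ≤ m' := hT'.le_index hmR' (by linarith [(h M).cast_nonneg (α := ℝ)])
  obtain ⟨hS, -, -, hg', hlt, -⟩ := hM m hMm
  obtain ⟨-, hS', hg, -, -, hgt⟩ := hM m' hMm'
  have hp : (0 : ℝ) < h m := by exact_mod_cast hT.hpos m
  have hp' : (0 : ℝ) < h' m' := by exact_mod_cast hT'.hpos m'
  have hpm' : (0 : ℝ) < h' m := by exact_mod_cast hT'.hpos m
  rw [div_lt_iff₀ hpm'] at hlt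
  rw [lt_div_iff₀ hp'] at hgt
  obtain ⟨h₁, h₂⟩ := abs_le.1 hmR
  obtain ⟨h₃, h₄⟩ := abs_le.1 hmR'
  have hη_m : η * h m < 1 / 8 * h m := by gcongr
  have hη_m' : η * h' m' < 1 / 8 * h' m' := by gcongr
  rcases lt_trichotomy m m' with hlt_m | rfl | hlt_m
  · have : (h' (m + 1) : ℝ) ≤ h' m' := by exact_mod_cast hT'.height_mono hlt_m
    have : 0 < η * h' m := by positivity
    linarith
  · have : (1 - η) * h' m ≤ (1 + η) * ((1 - 4 * η) * h' m) := by
      calc (1 - η) * h' m ≤ (1 + η) * h m := by linarith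
        _ ≤ (1 + η) * ((1 - 4 * η) * h' m) := by gcongr
    nlinarith [mul_pos hη₀ hpm', mul_pos (mul_pos hη₀ hη₀) hpm']
  · have hmono : (h (m' + 1) : ℝ) ≤ h m := by exact_mod_cast hT.height_mono hlt_m
    have : 4 * (h' m' : ℝ) ≤ 8 / q * h m' := by
      calc 4 * (h' m' : ℝ) = 8 / q * (q / 2 * h' m') := by field_simp; norm_num
        _ ≤ 8 / q * h m' := by gcongr
    linarith

end TwoColumnCutStack

/-- **Assertion 2.** If `T` and `T'` are two-column rank-one constructions whose
heights satisfy `h_j / h'_j → a/b` with `0 < a < b`, then the product `T × T'`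
is dissipative: some measurable `D ⊆ X × X'` has pairwise disjoint images under
all integer powers of `T × T'`, with conull union. -/
theorem product_of_scaled_constructions_dissipative
    {X X' : Type*} [MeasurableSpace X] [MeasurableSpace X']
    (μ : Measure X) [SigmaFinite μ] (μ' : Measure X') [SigmaFinite μ']
    (a b : ℝ) (ha : 0 < a) (hab : a < b)
    (T : Equiv.Perm X) (E : ℕ → Set X) (h : ℕ → ℕ) (s : ℕ → ℕ)
    (hT : TwoColumnCutStack μ T E h s)
    (T' : Equiv.Perm X') (E' : ℕ → Set X') (h' : ℕ → ℕ) (s' : ℕ → ℕ)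
    (hT' : TwoColumnCutStack μ' T' E' h' s')
    (hratio : Tendsto (fun j => (h j : ℝ) / (h' j : ℝ)) atTop (𝓝 (a / b))) :
    ∃ D : Set (X × X'), MeasurableSet D ∧
      (∀ i i' : ℤ, i ≠ i' →
        Disjoint ((⇑((Equiv.prodCongr T T') ^ i)) '' D)
          ((⇑((Equiv.prodCongr T T') ^ i')) '' D)) ∧
      (μ.prod μ') ((⋃ i : ℤ, (⇑((Equiv.prodCongr T T') ^ i)) '' D)ᶜ) = 0 := by
  have hb : 0 < b := ha.trans hab
  obtain ⟨N, hN⟩ := hT.exists_bound_common_return hT' (div_pos ha hb) ((div_lt_one hb).2 hab)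
    hratio
  let A : ℕ → Set X := fun k => (T ^ (k : ℤ) : Equiv.Perm X) '' E 0
  let A' : ℕ → Set X' := fun k => (T' ^ (k : ℤ) : Equiv.Perm X') '' E' 0
  obtain ⟨D, hD, hdisj, hcov⟩ := exists_wandering_of_bounded_returns
    (S := Equiv.prodCongr T T') (R := fun n => A n.unpair.1 ×ˢ A' n.unpair.2) (N := N)
    (hT.measT.prodMap hT'.measT) (hT.measTsymm.prodMap hT'.measTsymm)
    (fun n => (Equiv.Perm.measurableSet_zpow_image hT.measT hT.measTsymm _ (hT.measE 0)).prod
      (Equiv.Perm.measurableSet_zpow_image hT'.measT hT'.measTsymm _ (hT'.measE 0))) (by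
      rintro n i hi ⟨_, _⟩ ⟨⟨x, hx, rfl⟩, ⟨x', hx', rfl⟩⟩ hmem
      rw [Equiv.Perm.prodCongr_zpow_apply] at hmem
      obtain ⟨⟨y, hy, hyx⟩, ⟨y', hy', hyx'⟩⟩ := hmem
      dsimp only at hyx hyx'
      rw [← Equiv.Perm.mul_apply, ← zpow_add, add_comm, zpow_add, Equiv.Perm.mul_apply] at hyx hyx'
      rw [Equiv.injective _ hyx] at hy
      rw [Equiv.injective _ hyx'] at hy'
      exact hN i hi x hx hy x' hx' hy')
  refine ⟨D, hD, hdisj, ?_⟩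
  have hnull : (μ.prod μ') (((⋃ k, A k)ᶜ ×ˢ univ) ∪ (univ ×ˢ (⋃ k, A' k)ᶜ)) = 0 := by
    rw [measure_union_null_iff, Measure.prod_prod, Measure.prod_prod,
      hT.measure_compl_iUnion_base, hT'.measure_compl_iUnion_base]
    simp
  refine measure_mono_null ?_ hnull
  rintro ⟨x, x'⟩ hx
  by_contra hcon
  simp only [mem_union, mem_prod, mem_compl_iff, mem_univ, and_true, true_and, not_or,
    not_not, mem_iUnion] at hcon
  obtain ⟨⟨k, hk⟩, ⟨k', hk'⟩⟩ := hcon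
  exact hx (hcov (mem_iUnion.2 ⟨Nat.pair k k', by simpa using ⟨hk, hk'⟩⟩))
end

section
/- Fix N ≥ 2 and let T be the rank-one cutting-and-stacking transformation with N+1 columns at each stage, no spacers over columns 1,…,N−1, spacers s_j(N) over column N satisfying s_j(N) ≤ j, and spacers s_j(N+1) over the last column with s_j(N+1)/h_j → ∞. Then for every integer n > N the product T×T^n is a dissipative transformation of (X×X, μ×μ): there is a measurable set D ⊆ X×X such that the sets (T×T^n)^iD, i∈ℤ, are pairwise disjoint and their union is conull. -/
open MeasureTheory Filter Topology Set
open scoped ENNReal symmDiff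

/-- The `(N+1)`-column rank-one cutting-and-stacking construction of Theorem 2:
at stage `j` the tower `E_j, TE_j, …, T^{h_j-1}E_j` is cut into `N+1` equal
columns `C j 1, …, C j (N+1)` with `T^{h_j} C_j^i = C_j^{i+1}` for
`1 ≤ i ≤ N-1` and `T^{h_j + sN j} C_j^N = C_j^{N+1}`; `E_{j+1} = C_j^1` and
`h_{j+1} = (N+1) h_j + sN j + sN1 j`; the spacers satisfy `sN j ≤ j` and
`sN1 j / h_j → ∞`; the levels cover `X` up to a null set, every set of finite
measure is approximated by unions of levels, and `μ(X) = ∞`. -/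
structure NPlusOneColumnCutStack {X : Type*} [MeasurableSpace X] (μ : Measure X)
    (T : Equiv.Perm X) (N : ℕ) (E : ℕ → Set X) (C : ℕ → ℕ → Set X)
    (h : ℕ → ℕ) (sN sN1 : ℕ → ℕ) : Prop where
  two_le_N : 2 ≤ N
  measT : Measurable (⇑T)
  measTsymm : Measurable (⇑T.symm)
  mp : MeasurePreserving ⇑T μ μ
  infiniteMeasure : μ Set.univ = ∞
  measE : ∀ j, MeasurableSet (E j)
  measC : ∀ j i, MeasurableSet (C j i)
  hpos : ∀ j, 0 < h j
  disjLevels : ∀ j, ∀ i i' : ℕ, i < h j → i' < h j → i ≠ i' →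
    Disjoint ((⇑(T ^ (i : ℤ))) '' E j) ((⇑(T ^ (i' : ℤ))) '' E j)
  colUnion : ∀ j, E j = ⋃ i ∈ Finset.Icc 1 (N + 1), C j i
  colDisj : ∀ j, ∀ i ∈ Finset.Icc 1 (N + 1), ∀ i' ∈ Finset.Icc 1 (N + 1), i ≠ i' →
    Disjoint (C j i) (C j i')
  colMeasure : ∀ j, ∀ i ∈ Finset.Icc 1 (N + 1), μ (C j i) = μ (E j) / (N + 1)
  colNext : ∀ j, ∀ i, 1 ≤ i → i ≤ N - 1 →
    (⇑(T ^ (h j : ℤ))) '' C j i = C j (i + 1)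
  colNextN : ∀ j, (⇑(T ^ ((h j + sN j : ℕ) : ℤ))) '' C j N = C j (N + 1)
  base : ∀ j, E (j + 1) = C j 1
  height : ∀ j, h (j + 1) = (N + 1) * h j + sN j + sN1 j
  cover : μ ((⋃ j, ⋃ i ∈ Finset.range (h j), (⇑(T ^ (i : ℤ))) '' E j)ᶜ) = 0
  approx : ∀ A : Set X, MeasurableSet A → μ A < ∞ → ∀ ε : ℝ≥0∞, 0 < ε →
    ∀ᶠ j in atTop, ∃ I : Finset ℕ, (∀ i ∈ I, i < h j) ∧
      μ (symmDiff A (⋃ i ∈ I, (⇑(T ^ (i : ℤ))) '' E j)) < ε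
  sN_le : ∀ j, sN j ≤ j
  sN1Growth : Tendsto (fun j => (sN1 j : ℝ) / (h j : ℝ)) atTop atTop

/-- A measurable permutation for which the points of each set of an almost covering sequence
return to that set only within bounded time admits a wandering set whose orbit is conull. -/
theorem exists_wandering_of_bounded_returns_s14 {Z : Type*} [MeasurableSpace Z] (ν : Measure Z)
    (S : Equiv.Perm Z) (hS : ∀ i : ℤ, Measurable ⇑(S ^ i)) (B : ℕ → Set Z)
    (hB : ∀ k, MeasurableSet (B k))
    (hbdd : ∀ k, ∃ M : ℕ, ∀ z ∈ B k, ∀ i : ℕ, M ≤ i → (S ^ (i : ℤ)) z ∉ B k)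
    (hcover : ν (⋃ k, B k)ᶜ = 0) :
    ∃ D : Set Z, MeasurableSet D ∧
      (∀ i i' : ℤ, i ≠ i' → Disjoint (⇑(S ^ i) '' D) (⇑(S ^ i') '' D)) ∧
      ν (⋃ i : ℤ, ⇑(S ^ i) '' D)ᶜ = 0 := by
  set L : ℕ → Set Z := fun k => B k ∩ ⋂ i : ℕ, (⇑(S ^ ((i + 1 : ℕ) : ℤ)) ⁻¹' B k)ᶜ with hL
  set sat : ℕ → Set Z := fun k => ⋃ i : ℤ, ⇑(S ^ i) ⁻¹' B k with hsat
  set D : Set Z := ⋃ k, L k \ ⋃ l ∈ Finset.range k, sat l with hD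
  have sat_zpow : ∀ k z (i : ℤ), (S ^ i) z ∈ sat k → z ∈ sat k := by
    intro k z i hz
    obtain ⟨m, hm⟩ := mem_iUnion.1 hz
    refine mem_iUnion.2 ⟨m + i, ?_⟩
    simpa [zpow_add] using hm
  have L_sat : ∀ k, L k ⊆ sat k := fun k z hz => mem_iUnion.2 ⟨0, by simpa using hz.1⟩
  have wander : ∀ d ∈ D, ∀ m : ℕ, (S ^ ((m + 1 : ℕ) : ℤ)) d ∉ D := by
    intro d hd m hd'
    obtain ⟨k, hk, hk'⟩ := mem_iUnion.1 hd
    obtain ⟨l, hl, hl'⟩ := mem_iUnion.1 hd'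
    rcases lt_trichotomy k l with hkl | rfl | hkl
    · refine hl' (mem_biUnion (Finset.mem_coe.2 (Finset.mem_range.2 hkl)) ?_)
      apply sat_zpow k _ (-((m + 1 : ℕ) : ℤ))
      rw [← Equiv.Perm.mul_apply, ← zpow_add]
      simpa using L_sat k hk
    · exact mem_iInter.1 hk.2 m hl.1
    · exact hk' (mem_biUnion (Finset.mem_coe.2 (Finset.mem_range.2 hkl))
        (sat_zpow l _ _ (L_sat l hl)))
  have disj : ∀ i i' : ℤ, i < i' → Disjoint (⇑(S ^ i) '' D) (⇑(S ^ i') '' D) := by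
    intro i i' hii
    rw [Set.disjoint_left]
    rintro _ ⟨d, hd, rfl⟩ ⟨d', hd', h⟩
    obtain ⟨m, hm⟩ : ∃ m : ℕ, i' = i + ((m + 1 : ℕ) : ℤ) := ⟨(i' - i - 1).toNat, by omega⟩
    rw [hm, zpow_add, Equiv.Perm.mul_apply] at h
    exact wander d' hd' m ((S ^ i).injective h ▸ hd)
  refine ⟨D, ?_, ?_, ?_⟩
  · refine MeasurableSet.iUnion fun k => MeasurableSet.diff ?_ ?_
    · exact (hB k).inter (MeasurableSet.iInter fun i => (hS _ (hB k)).compl)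
    · exact Finset.measurableSet_biUnion _ fun l _ =>
        MeasurableSet.iUnion fun i => hS i (hB l)
  · intro i i' hii
    rcases lt_or_gt_of_ne hii with h | h
    · exact disj i i' h
    · exact (disj i' i h).symm
  · refine measure_mono_null (compl_subset_compl.2 ?_) hcover
    intro z hz
    classical
    have hex : ∃ l, z ∈ sat l := by
      obtain ⟨k, hk⟩ := mem_iUnion.1 hz
      exact ⟨k, mem_iUnion.2 ⟨0, by simpa using hk⟩⟩
    obtain ⟨i, hi⟩ := mem_iUnion.1 (Nat.find_spec hex)
    set l := Nat.find hex with hl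
    obtain ⟨M, hM⟩ := hbdd l
    set w := (S ^ i) z with hw
    let P : ℕ → Prop := fun m => (S ^ (m : ℤ)) w ∈ B l
    have hP0 : P 0 := by simpa [P] using hi
    have hg : P (Nat.findGreatest P M) := Nat.findGreatest_spec (Nat.zero_le M) hP0
    set g := Nat.findGreatest P M with hgdef
    have hlast : (S ^ (g : ℤ)) w ∈ D := by
      refine mem_iUnion.2 ⟨l, ⟨hg, mem_iInter.2 fun m hm => ?_⟩, ?_⟩
      · have hm' : P (m + 1 + g) := by
          simpa only [P, mem_preimage, ← Equiv.Perm.mul_apply, ← zpow_add, ← Nat.cast_add]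
            using hm
        rcases le_or_gt M (m + 1 + g) with h | h
        · exact hM w hi _ h hm'
        · have := Nat.le_findGreatest h.le hm'
          omega
      · intro h
        obtain ⟨k, hk, hk'⟩ := mem_iUnion₂.1 h
        exact Nat.find_min hex (Finset.mem_range.1 hk)
          (sat_zpow k z i (sat_zpow k _ _ hk'))
    refine mem_iUnion.2 ⟨-(g + i), _, hlast, ?_⟩
    rw [hw, ← Equiv.Perm.mul_apply, ← Equiv.Perm.mul_apply, ← zpow_add, ← zpow_add]
    simp

theorem measurable_perm_zpow {X : Type*} [MeasurableSpace X] {T : Equiv.Perm X}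
    (h : Measurable ⇑T) (h' : Measurable ⇑T.symm) (i : ℤ) : Measurable ⇑(T ^ i) := by
  rcases i with k | k
  · rw [Int.ofNat_eq_natCast, zpow_natCast, ← Equiv.Perm.iterate_eq_pow]
    exact h.iterate k
  · rw [zpow_negSucc, ← inv_pow, ← Equiv.Perm.iterate_eq_pow]
    exact h'.iterate (k + 1)

theorem prodCongr_zpow_apply {X Y : Type*} (f : Equiv.Perm X) (g : Equiv.Perm Y) (i : ℤ)
    (z : X × Y) : ((Equiv.prodCongr f g : Equiv.Perm (X × Y)) ^ i) z
      = ((f ^ i) z.1, (g ^ i) z.2) := by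
  let φ : Equiv.Perm X × Equiv.Perm Y →* Equiv.Perm (X × Y) :=
    { toFun := fun p => Equiv.prodCongr p.1 p.2
      map_one' := rfl
      map_mul' := fun _ _ => rfl }
  exact (Equiv.congr_fun (map_zpow φ (f, g) i) z).symm

/-- If shifting by `i` and by `n * i` both carry a point of a block of length `R` to another such
block, the blocks starting at small multiples of a much larger `H`, then `i < R`. -/
theorem lt_of_block_shift {N n H R α α' β β' r r' t t' i : ℕ} (hn : N < n)
    (hβ' : β' ≤ N) (hr : r < R) (hr' : r' < R) (ht : t < R) (ht' : t' < R)
    (hR : (n + 1) * R ≤ H) (h₁ : α' * H + r' = α * H + r + i)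
    (h₂ : β' * H + t' = β * H + t + n * i) : i < R := by
  zify at *
  have key : ((n : ℤ) * (α' - α) - (β' - β)) * H = n * (r - r') + (t' - t) := by
    linear_combination (n : ℤ) * h₁ - h₂
  have hn0 : (0 : ℤ) < n := by linarith [Int.natCast_nonneg N]
  have hH : (0 : ℤ) < H := by nlinarith
  have b1 : (n : ℤ) * (r - r') ≤ n * R := by gcongr; linarith
  have b2 : -(n * R : ℤ) ≤ n * (r - r') := by nlinarith
  have hz : (n : ℤ) * (α' - α) - (β' - β) = 0 := by
    by_contra hne
    rcases lt_or_gt_of_ne hne with h | h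
    · have : ((n : ℤ) * (α' - α) - (β' - β)) * H ≤ (-1) * H := by gcongr; linarith
      linarith
    · have : 1 * (H : ℤ) ≤ ((n : ℤ) * (α' - α) - (β' - β)) * H := by gcongr; linarith
      linarith
  have hle : (α' : ℤ) ≤ α := by
    by_contra hlt
    have : (n : ℤ) * 1 ≤ n * (α' - α) := by gcongr; linarith
    linarith
  have : ((α' : ℤ)) * H ≤ α * H := by gcongr
  linarith

namespace NPlusOneColumnCutStack

variable {X : Type*} [MeasurableSpace X] {μ : Measure X} {T : Equiv.Perm X} {N : ℕ}
  {E : ℕ → Set X} {C : ℕ → ℕ → Set X} {h : ℕ → ℕ} {sN sN1 : ℕ → ℕ}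

theorem three_mul_height_le (hT : NPlusOneColumnCutStack μ T N E C h sN sN1) (j : ℕ) :
    3 * h j ≤ h (j + 1) := by
  have := hT.two_le_N
  rw [hT.height j]
  nlinarith

theorem lt_height (hT : NPlusOneColumnCutStack μ T N E C h sN sN1) (j : ℕ) : j < h j := by
  induction j with
  | zero => exact hT.hpos 0
  | succ j ih =>
    have := hT.three_mul_height_le j
    omega

theorem eventually_mul_height_le (hT : NPlusOneColumnCutStack μ T N E C h sN sN1) (c : ℕ) :
    ∀ᶠ j in atTop, c * h j ≤ h (j + 1) := by
  filter_upwards [hT.sN1Growth.eventually_ge_atTop (c : ℝ)] with j hj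
  have hpos : (0 : ℝ) < h j := by exact_mod_cast hT.hpos j
  rw [le_div_iff₀ hpos] at hj
  have : c * h j ≤ sN1 j := by exact_mod_cast hj
  rw [hT.height j]
  omega

theorem exists_base_of_mem_column (hT : NPlusOneColumnCutStack μ T N E C h sN sN1) (j : ℕ) :
    ∀ i < N, ∀ x ∈ C j (i + 1), ∃ e ∈ E (j + 1), (T ^ ((i * h j : ℕ) : ℤ)) e = x := by
  intro i
  induction i with
  | zero => exact fun _ x hx => ⟨x, by simpa [hT.base j] using hx, by simp⟩
  | succ i ih =>
    intro hi x hx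
    rw [← hT.colNext j (i + 1) (by omega) (by omega)] at hx
    obtain ⟨y, hy, rfl⟩ := hx
    obtain ⟨e, he, rfl⟩ := ih (by omega) y hy
    refine ⟨e, he, ?_⟩
    rw [← Equiv.Perm.mul_apply, ← zpow_add]
    congr 2
    push_cast
    ring

/-- Each level of the tower at stage `j` sits over the base of stage `j + 1`. -/
theorem exists_base_succ (hT : NPlusOneColumnCutStack μ T N E C h sN sN1) {j m : ℕ} {e : X}
    (he : e ∈ E j) : ∃ α ≤ N, ∃ σ ≤ sN j, ∃ e' ∈ E (j + 1),
      (T ^ ((α * h j + σ + m : ℕ) : ℤ)) e' = (T ^ (m : ℤ)) e := by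
  have hN := hT.two_le_N
  suffices ∃ α ≤ N, ∃ σ ≤ sN j, ∃ e' ∈ E (j + 1), (T ^ ((α * h j + σ : ℕ) : ℤ)) e' = e by
    obtain ⟨α, hα, σ, hσ, e', he', rfl⟩ := this
    refine ⟨α, hα, σ, hσ, e', he', ?_⟩
    rw [← Equiv.Perm.mul_apply, ← zpow_add]
    congr 2
    push_cast
    ring
  rw [hT.colUnion j] at he
  obtain ⟨i, hi, hei⟩ := mem_iUnion₂.1 he
  rw [Finset.mem_Icc] at hi
  rcases Nat.lt_or_ge i (N + 1) with hiN | hiN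
  · obtain ⟨e', he', h'⟩ := hT.exists_base_of_mem_column j (i - 1) (by omega) e
      (by rwa [Nat.sub_add_cancel hi.1])
    exact ⟨i - 1, by omega, 0, Nat.zero_le _, e', he', h'⟩
  · obtain rfl : i = N + 1 := by omega
    rw [← hT.colNextN j] at hei
    obtain ⟨y, hy, rfl⟩ := hei
    obtain ⟨e', he', rfl⟩ := hT.exists_base_of_mem_column j (N - 1) (by omega) y
      (by rwa [Nat.sub_add_cancel (by omega)])
    refine ⟨N, le_rfl, sN j, le_rfl, e', he', ?_⟩
    rw [← Equiv.Perm.mul_apply, ← zpow_add]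
    congr 2
    obtain ⟨M, rfl⟩ : ∃ M, N = M + 1 := ⟨N - 1, by omega⟩
    push_cast [Nat.add_sub_cancel]
    ring

theorem exists_base_add_two (hT : NPlusOneColumnCutStack μ T N E C h sN sN1) {j m : ℕ} {e : X}
    (he : e ∈ E j) (hm : m < h j) : ∃ α ≤ N, ∃ r < (N + 3) * h j, ∃ e' ∈ E (j + 2),
      (T ^ ((α * h (j + 1) + r : ℕ) : ℤ)) e' = (T ^ (m : ℤ)) e := by
  obtain ⟨α, hα, σ, hσ, e₁, he₁, h₁⟩ := hT.exists_base_succ (m := m) he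
  obtain ⟨β, hβ, τ, hτ, e₂, he₂, h₂⟩ := hT.exists_base_succ (m := α * h j + σ + m) he₁
  refine ⟨β, hβ, τ + (α * h j + σ + m), ?_, e₂, he₂, ?_⟩
  · have h1 := hT.sN_le j
    have h2 := hT.sN_le (j + 1)
    have h3 := hT.lt_height j
    have h4 : α * h j ≤ N * h j := Nat.mul_le_mul_right _ hα
    nlinarith
  · rw [← h₁, ← h₂]
    congr 3
    ring

theorem height_unique (hT : NPlusOneColumnCutStack μ T N E C h sN sN1) {j p p' i : ℕ} {e e' : X}
    (he : e ∈ E j) (he' : e' ∈ E j) (hp : p + i < h j) (hp' : p' < h j)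
    (heq : (T ^ (p' : ℤ)) e' = (T ^ (i : ℤ)) ((T ^ (p : ℤ)) e)) : p' = p + i := by
  by_contra hne
  refine Set.disjoint_left.1 (hT.disjLevels j p' (p + i) hp' hp hne) ⟨e', he', rfl⟩ ⟨e, he, ?_⟩
  rw [heq, ← Equiv.Perm.mul_apply, ← zpow_add]
  congr 2
  push_cast
  ring

variable (T E h) in
/-- The union of the levels of the tower at stage `j`. -/
def tower (j : ℕ) : Set X := ⋃ i ∈ Finset.range (h j), ⇑(T ^ (i : ℤ)) '' E j

theorem mem_tower {j : ℕ} {x : X} :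
    x ∈ tower T E h j ↔ ∃ m < h j, ∃ e ∈ E j, (T ^ (m : ℤ)) e = x := by
  simp only [tower, mem_iUnion₂, Finset.mem_range, mem_image, exists_prop]

theorem measurableSet_tower (hT : NPlusOneColumnCutStack μ T N E C h sN sN1) (j : ℕ) :
    MeasurableSet (tower T E h j) := by
  refine Finset.measurableSet_biUnion _ fun i _ => ?_
  rw [Equiv.image_eq_preimage_symm]
  have := measurable_perm_zpow hT.measT hT.measTsymm (-(i : ℤ)) (hT.measE j)
  rwa [zpow_neg] at this

theorem tower_mono (hT : NPlusOneColumnCutStack μ T N E C h sN sN1) : Monotone (tower T E h) := by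
  refine monotone_nat_of_le_succ fun j x hx => ?_
  obtain ⟨m, hm, e, he, rfl⟩ := mem_tower.1 hx
  obtain ⟨α, hα, σ, hσ, e', he', h'⟩ := hT.exists_base_succ (m := m) he
  refine mem_tower.2 ⟨_, ?_, e', he', h'⟩
  have h4 : α * h j ≤ N * h j := Nat.mul_le_mul_right _ hα
  rw [hT.height j]
  nlinarith

/-- A pair of points of the tower at stage `j` that is again in this tower after times `i` and
`n * i` has either a short return time or one comparable to the height of stage `j + 2`. -/
theorem return_lt (hT : NPlusOneColumnCutStack μ T N E C h sN sN1) {n j i : ℕ} (hn : N < n)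
    {x y : X} (hx : x ∈ tower T E h j) (hy : y ∈ tower T E h j)
    (hx' : (T ^ (i : ℤ)) x ∈ tower T E h j)
    (hy' : (T ^ ((n * i : ℕ) : ℤ)) y ∈ tower T E h j)
    (hgrow : (n + 1) * ((N + 3) * h j) ≤ h (j + 1))
    (hi : (N + 1) * h (j + 1) + n * i ≤ h (j + 2)) : i < (N + 3) * h j := by
  have key : ∀ x ∈ tower T E h j, ∃ α ≤ N, ∃ r < (N + 3) * h j,
      α * h (j + 1) + r < (N + 1) * h (j + 1) ∧
      ∃ e ∈ E (j + 2), (T ^ ((α * h (j + 1) + r : ℕ) : ℤ)) e = x := by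
    intro x hx
    obtain ⟨m, hm, e, he, rfl⟩ := mem_tower.1 hx
    obtain ⟨α, hα, r, hr, H⟩ := hT.exists_base_add_two he hm
    refine ⟨α, hα, r, hr, ?_, H⟩
    have h1 : α * h (j + 1) ≤ N * h (j + 1) := Nat.mul_le_mul_right _ hα
    nlinarith
  obtain ⟨α, hα, r, hr, hb, e, he, rfl⟩ := key x hx
  obtain ⟨β, hβ, t, ht, hc, f, hf, rfl⟩ := key y hy
  obtain ⟨α', hα', r', hr', hb', e', he', hxe⟩ := key _ hx'
  obtain ⟨β', hβ', t', ht', hc', f', hf', hyf⟩ := key _ hy'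
  have hin : i ≤ n * i := Nat.le_mul_of_pos_left i (by omega)
  exact lt_of_block_shift hn hβ' hr hr' ht ht' hgrow
    (hT.height_unique he he' (by omega) (by omega) hxe)
    (hT.height_unique hf hf' (by omega) (by omega) hyf)

theorem exists_return_bound (hT : NPlusOneColumnCutStack μ T N E C h sN sN1) {n : ℕ} (hn : N < n)
    (k : ℕ) : ∃ M : ℕ, ∀ x ∈ tower T E h k, ∀ y ∈ tower T E h k, ∀ i : ℕ, M ≤ i →
      (T ^ (i : ℤ)) x ∈ tower T E h k → (T ^ ((n * i : ℕ) : ℤ)) y ∉ tower T E h k := by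
  obtain ⟨J, hJ⟩ := eventually_atTop.1
    ((hT.eventually_mul_height_le ((n + 1) * (N + 3))).and
      (hT.eventually_mul_height_le (N + 1 + n * (N + 3))))
  refine ⟨(N + 3) * h (max J k), fun x hx y hy i hi hx' hy' => ?_⟩
  have hlt : ∀ j, max J k ≤ j → (N + 3) * h j ≤ i := by
    intro j hj
    induction j, hj using Nat.le_induction with
    | base => exact hi
    | succ j hj ih =>
      by_contra! hlt
      have hkj : k ≤ j := (le_max_right _ _).trans hj
      have hJj : J ≤ j := (le_max_left _ _).trans hj
      have hsub := hT.tower_mono hkj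
      have h2 := (hJ (j + 1) (by omega)).2
      have hni : n * i ≤ n * ((N + 3) * h (j + 1)) := Nat.mul_le_mul_left _ hlt.le
      have := hT.return_lt hn (hsub hx) (hsub hy) (hsub hx') (hsub hy')
        (by rw [← mul_assoc]; exact (hJ j hJj).1) (by nlinarith)
      omega
  have h1 := hlt (max (max J k) i) (le_max_left _ _)
  have h2 := hT.lt_height (max (max J k) i)
  have h3 : i ≤ max (max J k) i := le_max_right _ _
  nlinarith

end NPlusOneColumnCutStack

/-- Dissipativity part of **Theorem 2**: for the `(N+1)`-column construction and
every integer `n > N`, the product `T × T^n` is dissipative. -/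
theorem product_with_large_power_dissipative
    {X : Type*} [MeasurableSpace X] (μ : Measure X) [SigmaFinite μ]
    (N : ℕ) (T : Equiv.Perm X) (E : ℕ → Set X) (C : ℕ → ℕ → Set X)
    (h : ℕ → ℕ) (sN sN1 : ℕ → ℕ)
    (hT : NPlusOneColumnCutStack μ T N E C h sN sN1)
    (n : ℤ) (hn : (N : ℤ) < n) :
    ∃ D : Set (X × X), MeasurableSet D ∧
      (∀ i i' : ℤ, i ≠ i' →
        Disjoint ((⇑((Equiv.prodCongr T (T ^ n)) ^ i)) '' D)
          ((⇑((Equiv.prodCongr T (T ^ n)) ^ i')) '' D)) ∧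
      (μ.prod μ) ((⋃ i : ℤ, (⇑((Equiv.prodCongr T (T ^ n)) ^ i)) '' D)ᶜ) = 0 := by
  lift n to ℕ using by omega
  have hn' : N < n := by exact_mod_cast hn
  have hmeas := measurable_perm_zpow hT.measT hT.measTsymm
  refine exists_wandering_of_bounded_returns_s14 (μ.prod μ) _ ?_
    (fun k => NPlusOneColumnCutStack.tower T E h k ×ˢ NPlusOneColumnCutStack.tower T E h k)
    (fun k => (hT.measurableSet_tower k).prod (hT.measurableSet_tower k)) ?_ ?_
  · intro i
    have heq : ⇑((Equiv.prodCongr T (T ^ (n : ℤ)) : Equiv.Perm (X × X)) ^ i)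
        = Prod.map ⇑(T ^ i) ⇑(T ^ ((n : ℤ) * i)) := by
      ext1 z
      rw [prodCongr_zpow_apply, ← zpow_mul]
      rfl
    rw [heq]
    exact (hmeas i).prodMap (hmeas _)
  · intro k
    obtain ⟨M, hM⟩ := hT.exists_return_bound hn' k
    refine ⟨M, fun z hz i hi hzi => ?_⟩
    rw [prodCongr_zpow_apply, ← zpow_mul] at hzi
    exact hM z.1 hz.1 z.2 hz.2 i hi hzi.1 (by exact_mod_cast hzi.2)
  · set U : Set X := ⋃ j, NPlusOneColumnCutStack.tower T E h j with hU
    have hU0 : μ Uᶜ = 0 := hT.cover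
    have hsub : (⋃ k, NPlusOneColumnCutStack.tower T E h k ×ˢ
        NPlusOneColumnCutStack.tower T E h k)ᶜ ⊆ Uᶜ ×ˢ univ ∪ univ ×ˢ Uᶜ := by
      rintro ⟨x, y⟩ hxy
      by_contra hcon
      simp only [mem_union, mem_prod, mem_compl_iff, mem_univ, and_true, true_and, not_or,
        not_not] at hcon
      obtain ⟨a, ha⟩ := mem_iUnion.1 hcon.1
      obtain ⟨b, hb⟩ := mem_iUnion.1 hcon.2
      exact hxy (mem_iUnion.2 ⟨max a b, hT.tower_mono (le_max_left a b) ha,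
        hT.tower_mono (le_max_right a b) hb⟩)
    refine measure_mono_null hsub (measure_union_null ?_ ?_) <;>
      simp [Measure.prod_prod, hU0]
end

section
/- Fix N ≥ 2 and let T be the rank-one cutting-and-stacking transformation with N+1 columns at each stage, no spacers over columns 1,…,N−1, spacers s_j(N) over column N satisfying s_j(N) ≤ j and attaining every positive integer value for infinitely many j, and spacers s_j(N+1) over the last column with s_j(N+1)/h_j → ∞. Fix an integer p ≥ 1 and let j′ run through the (infinitely many) stages with s_{j′}(N) = p. Then for every n with 1 ≤ n ≤ N and all measurable sets A,B ⊆ X of finite measure, μ(T^{-n·h_{j′}}A ∩ B) → ((N−n)/(N+1))·μ(A ∩ B) + (1/(N+1))·μ(T^pA ∩ B) as j′ → ∞. -/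
open MeasureTheory Filter Topology Set
open scoped ENNReal symmDiff

section Translates

variable {X : Type*}

/-- The union of the translates `T ^ l '' S` over `l ∈ I`. -/
def translates (T : Equiv.Perm X) (S : Set X) (I : Finset ℕ) : Set X :=
  ⋃ l ∈ I, (⇑(T ^ (l : ℤ))) '' S

theorem zpow_image_image (T : Equiv.Perm X) (a b : ℤ) (S : Set X) :
    (⇑(T ^ a)) '' ((⇑(T ^ b)) '' S) = (⇑(T ^ (a + b))) '' S := by
  rw [← image_comp, zpow_add, Equiv.Perm.coe_mul]

theorem zpow_image_eq_preimage (T : Equiv.Perm X) (a : ℤ) (S : Set X) :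
    (⇑(T ^ a)) '' S = (⇑(T ^ (-a))) ⁻¹' S := by
  rw [zpow_neg]
  exact Equiv.image_eq_preimage_symm _ _

theorem zpow_image_translates (T : Equiv.Perm X) (a : ℤ) (S : Set X) (I : Finset ℕ) :
    (⇑(T ^ a)) '' translates T S I = translates T ((⇑(T ^ a)) '' S) I := by
  simp only [translates, image_iUnion, zpow_image_image, add_comm]

theorem image_inter_eq_image_inter_neg (T : Equiv.Perm X) (a : ℤ) (S B : Set X) :
    (⇑(T ^ a)) '' S ∩ B = (⇑(T ^ a)) '' (S ∩ (⇑(T ^ (-a))) '' B) := by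
  rw [image_inter (T ^ a).injective, zpow_image_image]
  simp

theorem translates_mono (T : Equiv.Perm X) {S S' : Set X} {I I' : Finset ℕ} (hS : S ⊆ S')
    (hI : I ⊆ I') : translates T S I ⊆ translates T S' I' :=
  biUnion_mono hI fun _ _ => image_mono hS

end Translates

section MeasureEstimates

variable {X : Type*} [MeasurableSpace X] {μ : Measure X}

theorem measurePreserving_zpow {T : Equiv.Perm X} (hT : MeasurePreserving T μ μ)
    (hsymm : Measurable T.symm) (a : ℤ) : MeasurePreserving (⇑(T ^ a)) μ μ := by
  have hinv : MeasurePreserving (⇑T⁻¹) μ μ :=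
    MeasurePreserving.symm (⟨T, hT.measurable, hsymm⟩ : X ≃ᵐ X) hT
  obtain ⟨n, rfl | rfl⟩ := a.eq_nat_or_neg
  · rw [zpow_natCast, ← Equiv.Perm.iterate_eq_pow]
    exact hT.iterate n
  · rw [zpow_neg, zpow_natCast, ← inv_pow, ← Equiv.Perm.iterate_eq_pow]
    exact hinv.iterate n

theorem measure_inter_le_add_symmDiff (S S' B : Set X) :
    μ (S ∩ B) ≤ μ (S' ∩ B) + μ (symmDiff S S') := by
  refine (measure_mono ?_).trans (measure_union_le _ _)
  rintro x ⟨hS, hB⟩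
  by_cases hx : x ∈ S'
  · exact Or.inl ⟨hx, hB⟩
  · exact Or.inr (Or.inl ⟨hS, hx⟩)

theorem tendsto_of_le_add_of_le_add {ι : Type*} {l : Filter ι} {a b d : ι → ℝ≥0∞} {L : ℝ≥0∞}
    (hb : Tendsto b l (𝓝 L)) (hd : Tendsto d l (𝓝 0)) (hab : ∀ i, a i ≤ b i + d i)
    (hba : ∀ i, b i ≤ a i + d i) : Tendsto a l (𝓝 L) := by
  have h1 : Tendsto (fun i => b i - d i) l (𝓝 L) := by
    simpa using ENNReal.Tendsto.sub hb hd (Or.inr ENNReal.zero_ne_top)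
  have h2 : Tendsto (fun i => b i + d i) l (𝓝 L) := by simpa using hb.add hd
  exact tendsto_of_tendsto_of_tendsto_of_le_of_le h1 h2
    (fun i => tsub_le_iff_right.2 (hba i)) hab

/-- Replacing sets by asymptotically equal ones does not affect limits of intersections. -/
theorem tendsto_measure_inter_congr {ι : Type*} {l : Filter ι} {S S' B : ι → Set X} {L : ℝ≥0∞}
    (h : Tendsto (fun i => μ (S' i ∩ B i)) l (𝓝 L))
    (hd : Tendsto (fun i => μ (symmDiff (S i) (S' i))) l (𝓝 0)) :
    Tendsto (fun i => μ (S i ∩ B i)) l (𝓝 L) :=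
  tendsto_of_le_add_of_le_add h hd (fun _ => measure_inter_le_add_symmDiff _ _ _) fun i => by
    rw [symmDiff_comm]
    exact measure_inter_le_add_symmDiff _ _ _

end MeasureEstimates

/-- The level of the next tower occupied by the base of the `i`-th column of a tower of height
`H`, when `s` spacers are put over the `N`-th column. -/
def columnLevel (N H s i : ℕ) : ℕ := (i - 1) * H + if i = N + 1 then s else 0

namespace NPlusOneColumnCutStack

variable {X : Type*} [MeasurableSpace X] {μ : Measure X} {T : Equiv.Perm X} {N : ℕ}
  {E : ℕ → Set X} {C : ℕ → ℕ → Set X} {h sN sN1 : ℕ → ℕ}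

theorem column_eq (hT : NPlusOneColumnCutStack μ T N E C h sN sN1) (j : ℕ) {i : ℕ}
    (hi : 1 ≤ i) (hi' : i ≤ N + 1) :
    C j i = (⇑(T ^ (columnLevel N (h j) (sN j) i : ℤ))) '' C j 1 := by
  have key : ∀ i, 1 ≤ i → i ≤ N → C j i = (⇑(T ^ (((i - 1) * h j : ℕ) : ℤ))) '' C j 1 := by
    intro i hi
    induction i, hi using Nat.le_induction with
    | base => simp
    | succ i hi ih =>
      intro hiN
      rw [← hT.colNext j i hi (by omega), ih (by omega), zpow_image_image]
      congr 3
      obtain ⟨k, rfl⟩ := Nat.exists_eq_add_of_le' hi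
      simp only [Nat.add_sub_cancel]
      push_cast
      ring
  have h2 := hT.two_le_N
  rcases hi'.lt_or_eq with hlt | rfl
  · rw [key i hi (by omega), columnLevel, if_neg (by omega), add_zero]
  · rw [← hT.colNextN j, key N (by omega) le_rfl, zpow_image_image, columnLevel, if_pos rfl]
    congr 3
    obtain ⟨k, rfl⟩ := Nat.exists_eq_add_of_le' (show 1 ≤ N by omega)
    simp only [Nat.add_sub_cancel]
    push_cast
    ring

theorem zpow_image_column (hT : NPlusOneColumnCutStack μ T N E C h sN sN1) (j : ℕ) {i i' : ℕ}
    (hi : i ∈ Finset.Icc 1 (N + 1)) (hi' : i' ∈ Finset.Icc 1 (N + 1)) (a b : ℤ)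
    (hab : a + columnLevel N (h j) (sN j) i = b + columnLevel N (h j) (sN j) i') :
    (⇑(T ^ a)) '' C j i = (⇑(T ^ b)) '' C j i' := by
  rw [Finset.mem_Icc] at hi hi'
  rw [hT.column_eq j hi.1 hi.2, hT.column_eq j hi'.1 hi'.2, zpow_image_image, zpow_image_image,
    hab]

theorem column_subset (hT : NPlusOneColumnCutStack μ T N E C h sN sN1) (j : ℕ) {i : ℕ}
    (hi : i ∈ Finset.Icc 1 (N + 1)) : C j i ⊆ E j := by
  rw [hT.colUnion j]
  exact subset_biUnion_of_mem (u := fun i => C j i) hi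

theorem measure_zpow_image (hT : NPlusOneColumnCutStack μ T N E C h sN sN1) (a : ℤ)
    {S : Set X} (hS : MeasurableSet S) : μ ((⇑(T ^ a)) '' S) = μ S := by
  rw [zpow_image_eq_preimage]
  exact (measurePreserving_zpow hT.mp hT.measTsymm _).measure_preimage hS.nullMeasurableSet

theorem measurableSet_zpow_image (hT : NPlusOneColumnCutStack μ T N E C h sN sN1) (a : ℤ)
    {S : Set X} (hS : MeasurableSet S) : MeasurableSet ((⇑(T ^ a)) '' S) := by
  rw [zpow_image_eq_preimage]
  exact (measurePreserving_zpow hT.mp hT.measTsymm _).measurable hS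

theorem measurableSet_translates (hT : NPlusOneColumnCutStack μ T N E C h sN sN1)
    {S : Set X} (hS : MeasurableSet S) (I : Finset ℕ) : MeasurableSet (translates T S I) :=
  I.measurableSet_biUnion fun _ _ => hT.measurableSet_zpow_image _ hS

/-- Distinct levels of the columns of a tower are disjoint. -/
theorem column_levels_disjoint (hT : NPlusOneColumnCutStack μ T N E C h sN sN1) (j : ℕ)
    {i i' l l' : ℕ} (hi : i ∈ Finset.Icc 1 (N + 1)) (hi' : i' ∈ Finset.Icc 1 (N + 1))
    (hl : l < h j) (hl' : l' < h j) (hne : (i, l) ≠ (i', l')) :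
    Disjoint ((⇑(T ^ (l : ℤ))) '' C j i) ((⇑(T ^ (l' : ℤ))) '' C j i') := by
  by_cases hll : l = l'
  · subst hll
    rw [disjoint_image_iff (T ^ (l : ℤ)).injective]
    exact hT.colDisj j i hi i' hi' fun h => hne (by rw [h])
  · exact (hT.disjLevels j l l' hl hl' hll).mono (image_mono (hT.column_subset j hi))
      (image_mono (hT.column_subset j hi'))

theorem translates_column_disjoint (hT : NPlusOneColumnCutStack μ T N E C h sN sN1) (j : ℕ)
    {i i' : ℕ} (hi : i ∈ Finset.Icc 1 (N + 1)) (hi' : i' ∈ Finset.Icc 1 (N + 1)) (hne : i ≠ i')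
    {I I' : Finset ℕ} (hI : ∀ l ∈ I, l < h j) (hI' : ∀ l ∈ I', l < h j) :
    Disjoint (translates T (C j i) I) (translates T (C j i') I') := by
  simp only [translates, disjoint_iUnion_left, disjoint_iUnion_right]
  exact fun l hl l' hl' => hT.column_levels_disjoint j hi hi' (hI _ hl') (hI' _ hl)
    fun h => hne (congrArg Prod.fst h)

theorem translates_eq_biUnion (hT : NPlusOneColumnCutStack μ T N E C h sN sN1) (j : ℕ)
    (I : Finset ℕ) :
    translates T (E j) I = ⋃ i ∈ Finset.Icc 1 (N + 1), translates T (C j i) I := by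
  rw [hT.colUnion j]
  simp only [translates, image_iUnion]
  rw [iUnion₂_comm]

theorem translates_inter_column (hT : NPlusOneColumnCutStack μ T N E C h sN sN1) (j : ℕ)
    {i : ℕ} (hi : i ∈ Finset.Icc 1 (N + 1)) {I : Finset ℕ} (hI : ∀ l ∈ I, l < h j) :
    translates T (E j) I ∩ translates T (C j i) (Finset.range (h j)) =
      translates T (C j i) I := by
  refine Subset.antisymm ?_ (subset_inter (translates_mono T (hT.column_subset j hi) subset_rfl)
    (translates_mono T subset_rfl fun l hl => Finset.mem_range.2 (hI l hl)))
  rintro x ⟨hx, hxi⟩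
  rw [hT.translates_eq_biUnion j, mem_iUnion₂] at hx
  obtain ⟨i', hi', hx⟩ := hx
  obtain rfl | hne := eq_or_ne i' i
  · exact hx
  · exact (disjoint_left.1 (hT.translates_column_disjoint j hi' hi hne hI
      fun l hl => Finset.mem_range.1 hl) hx hxi).elim

theorem measure_translates (hT : NPlusOneColumnCutStack μ T N E C h sN sN1) (j : ℕ)
    {S : Set X} (hS : MeasurableSet S) (hSE : S ⊆ E j) {I : Finset ℕ} (hI : ∀ l ∈ I, l < h j) :
    μ (translates T S I) = I.card * μ S := by
  rw [translates, measure_biUnion_finset _ fun l _ => hT.measurableSet_zpow_image _ hS]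
  · rw [Finset.sum_congr rfl fun l _ => hT.measure_zpow_image _ hS, Finset.sum_const,
      nsmul_eq_mul]
  · exact fun l hl l' hl' hne => (hT.disjLevels j l l' (hI l hl) (hI l' hl') hne).mono
      (image_mono hSE) (image_mono hSE)

theorem measure_translates_column (hT : NPlusOneColumnCutStack μ T N E C h sN sN1) (j : ℕ)
    {i : ℕ} (hi : i ∈ Finset.Icc 1 (N + 1)) {I : Finset ℕ} (hI : ∀ l ∈ I, l < h j) :
    μ (translates T (C j i) I) = μ (translates T (E j) I) / (N + 1) := by
  rw [hT.measure_translates j (hT.measC j i) (hT.column_subset j hi) hI,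
    hT.measure_translates j (hT.measE j) subset_rfl hI, hT.colMeasure j i hi, mul_div_assoc]

/-- Sets of finite measure are asymptotically equal to unions of levels. -/
theorem exists_levels_tendsto (hT : NPlusOneColumnCutStack μ T N E C h sN sN1) {A : Set X}
    (hA : MeasurableSet A) (hAfin : μ A < ∞) :
    ∃ I : ℕ → Finset ℕ, (∀ j, ∀ l ∈ I j, l < h j) ∧
      Tendsto (fun j => μ (symmDiff A (translates T (E j) (I j)))) atTop (𝓝 0) := by
  have hmin : ∀ j, ∃ I ∈ (Finset.range (h j)).powerset, ∀ I' ∈ (Finset.range (h j)).powerset,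
      μ (symmDiff A (translates T (E j) I)) ≤ μ (symmDiff A (translates T (E j) I')) :=
    fun j => Finset.exists_min_image _ _ ⟨∅, by simp⟩
  choose I hI hImin using hmin
  refine ⟨I, fun j l hl => Finset.mem_range.1 (Finset.mem_powerset.1 (hI j) hl), ?_⟩
  refine ENNReal.tendsto_nhds_zero.2 fun ε hε => ?_
  filter_upwards [hT.approx A hA hAfin ε hε] with j ⟨I', hI', hlt⟩
  exact (hImin j I' (Finset.mem_powerset.2 fun l hl => Finset.mem_range.2 (hI' l hl))).trans
    hlt.le

/-- The towers asymptotically exhaust every set of finite measure. -/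
theorem tendsto_measure_diff_tower (hT : NPlusOneColumnCutStack μ T N E C h sN sN1) {B : Set X}
    (hB : MeasurableSet B) (hBfin : μ B < ∞) :
    Tendsto (fun j => μ (B \ translates T (E j) (Finset.range (h j)))) atTop (𝓝 0) := by
  obtain ⟨I, hI, hlim⟩ := hT.exists_levels_tendsto hB hBfin
  refine tendsto_of_tendsto_of_tendsto_of_le_of_le tendsto_const_nhds hlim
    (fun _ => zero_le) fun j => measure_mono fun x hx => Or.inl ⟨hx.1, fun hx' => hx.2 ?_⟩
  exact translates_mono T subset_rfl (fun l hl => Finset.mem_range.2 (hI j l hl)) hx'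

/-- Each column asymptotically carries the fraction `1 / (N + 1)` of a set of finite measure. -/
theorem tendsto_measure_inter_column (hT : NPlusOneColumnCutStack μ T N E C h sN sN1)
    {D : Set X} (hD : MeasurableSet D) (hDfin : μ D < ∞) {i : ℕ}
    (hi : i ∈ Finset.Icc 1 (N + 1)) :
    Tendsto (fun j => μ (D ∩ translates T (C j i) (Finset.range (h j)))) atTop
      (𝓝 (μ D / (N + 1))) := by
  obtain ⟨I, hI, hlim⟩ := hT.exists_levels_tendsto hD hDfin
  refine tendsto_measure_inter_congr ?_ hlim
  simp only [fun j => hT.translates_inter_column j hi (hI j),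
    fun j => hT.measure_translates_column j hi (hI j)]
  refine ENNReal.Tendsto.div_const ?_ (Or.inr (by simp))
  have := tendsto_measure_inter_congr (μ := μ) (S := fun j => translates T (E j) (I j))
    (S' := fun _ => D) (B := fun _ => univ) (L := μ D) (l := atTop)
    (by simpa only [inter_univ] using tendsto_const_nhds)
    (by simpa only [symmDiff_comm] using hlim)
  simpa only [inter_univ] using this

/-- The column parts of the level unions approximating `A` inherit the proportions of `A`. -/
theorem tendsto_measure_translates_column_inter
    (hT : NPlusOneColumnCutStack μ T N E C h sN sN1) {A B : Set X} (hA : MeasurableSet A)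
    (hB : MeasurableSet B) (hAfin : μ A < ∞) {I : ℕ → Finset ℕ} (hI : ∀ j, ∀ l ∈ I j, l < h j)
    (hlim : Tendsto (fun j => μ (symmDiff A (translates T (E j) (I j)))) atTop (𝓝 0)) {i : ℕ}
    (hi : i ∈ Finset.Icc 1 (N + 1)) :
    Tendsto (fun j => μ (translates T (C j i) (I j) ∩ B)) atTop (𝓝 (μ (A ∩ B) / (N + 1))) := by
  have hAB := hT.tendsto_measure_inter_column (hA.inter hB)
    ((measure_mono inter_subset_left).trans_lt hAfin) hi
  simp only [inter_assoc] at hAB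
  have := tendsto_measure_inter_congr (S := fun j => translates T (E j) (I j)) hAB
    (by simpa only [symmDiff_comm] using hlim)
  refine this.congr fun j => ?_
  rw [← hT.translates_inter_column j hi (hI j), inter_assoc, inter_comm B]

theorem zpow_image_base_disjoint (hT : NPlusOneColumnCutStack μ T N E C h sN sN1) (j : ℕ)
    {a b : ℤ} (hab : a < b) (hba : b < a + h j) :
    Disjoint ((⇑(T ^ a)) '' E j) ((⇑(T ^ b)) '' E j) := by
  obtain ⟨k, rfl⟩ := Int.le.dest hab.le
  rw [← zpow_image_image, ← add_zero a, ← zpow_image_image, add_zero,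
    disjoint_image_iff (T ^ a).injective]
  simpa using hT.disjLevels j 0 k (hT.hpos j) (by omega) (by omega)

/-- Columns pushed below the base leave the tower when there are many spacers on top. -/
theorem zpow_image_column_disjoint_tower (hT : NPlusOneColumnCutStack μ T N E C h sN sN1)
    {j n i : ℕ} (hj : N * h j < sN1 j) (hn : n ≤ N) (hi : 1 ≤ i) (hin : i ≤ n)
    {I : Finset ℕ} (hI : ∀ l ∈ I, l < h j) :
    Disjoint ((⇑(T ^ (-((n : ℤ) * (h j : ℤ))))) '' translates T (C j i) I)
      (translates T (E j) (Finset.range (h j))) := by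
  rw [hT.translates_eq_biUnion, zpow_image_translates]
  simp only [translates, disjoint_iUnion_left, disjoint_iUnion_right]
  intro i' hi' l' hl' l hl
  rw [Finset.mem_Icc] at hi'
  rw [Finset.mem_range] at hl'
  have hl := hI l hl
  rw [hT.column_eq j hi (by omega), hT.column_eq j hi'.1 hi'.2, ← hT.base j]
  simp only [zpow_image_image]
  have hlev : columnLevel N (h j) (sN j) i + h j ≤ n * h j := by
    rw [columnLevel, if_neg (by omega), add_zero, ← Nat.succ_mul]
    exact Nat.mul_le_mul_right _ (by omega)
  have hlev' : columnLevel N (h j) (sN j) i' ≤ N * h j + sN j := by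
    rw [columnLevel]
    exact add_le_add (Nat.mul_le_mul_right _ (by omega)) (by split_ifs <;> simp)
  have hnN : n * h j ≤ N * h j := Nat.mul_le_mul_right _ hn
  have hheight : h (j + 1) = N * h j + h j + sN j + sN1 j := by rw [hT.height j]; ring
  zify at hlev hlev' hnN hheight hj hl hl'
  refine hT.zpow_image_base_disjoint (j + 1) ?_ ?_ <;> linarith

theorem eventually_mul_lt_spacers (hT : NPlusOneColumnCutStack μ T N E C h sN sN1) :
    ∀ᶠ j in atTop, N * h j < sN1 j := by
  filter_upwards [hT.sN1Growth.eventually_gt_atTop (N : ℝ)] with j hj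
  rw [lt_div_iff₀ (by exact_mod_cast hT.hpos j)] at hj
  exact_mod_cast hj

end NPlusOneColumnCutStack

/-- Formula (4) in the proof of **Theorem 2**: along the stages `j'` with
`s_{j'}(N) = p` one has the weak convergence
`T^{-n h_{j'}} → ((N-n)/(N+1)) I + (1/(N+1)) T^p` for `1 ≤ n ≤ N`. -/
theorem weak_limit_along_constant_spacer_stages
    {X : Type*} [MeasurableSpace X] (μ : Measure X) [SigmaFinite μ]
    (N : ℕ) (T : Equiv.Perm X) (E : ℕ → Set X) (C : ℕ → ℕ → Set X)
    (h : ℕ → ℕ) (sN sN1 : ℕ → ℕ)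
    (hT : NPlusOneColumnCutStack μ T N E C h sN sN1)
    (hio : ∀ q : ℕ, 1 ≤ q → {j : ℕ | sN j = q}.Infinite)
    (p : ℕ) (hp : 1 ≤ p)
    (φ : ℕ → ℕ) (hφmono : StrictMono φ) (hφ : ∀ k, sN (φ k) = p) :
    ∀ n : ℕ, 1 ≤ n → n ≤ N →
      ∀ A B : Set X, MeasurableSet A → MeasurableSet B → μ A < ∞ → μ B < ∞ →
        Tendsto (fun k => μ ((⇑(T ^ (-((n : ℤ) * (h (φ k) : ℤ))))) '' A ∩ B)) atTop
          (𝓝 (((N - n : ℕ) : ℝ≥0∞) / ((N : ℝ≥0∞) + 1) * μ (A ∩ B) +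
            (1 / ((N : ℝ≥0∞) + 1)) * μ ((⇑(T ^ (p : ℤ))) '' A ∩ B))) := by
  intro n hn hnN A B hA hB hAfin hBfin
  obtain ⟨I, hI, hlim⟩ := hT.exists_levels_tendsto hA hAfin
  have hφt := hφmono.tendsto_atTop
  set a : ℕ → ℤ := fun k => -((n : ℤ) * (h (φ k) : ℤ)) with ha
  have hmeas : ∀ j i, MeasurableSet (translates T (C j i) (I j)) :=
    fun j i => hT.measurableSet_translates (hT.measC j i) _
  -- approximate `A` by unions of levels and split these into columns
  suffices hsum : Tendsto (fun k => ∑ i ∈ Finset.Icc 1 (N + 1),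
      μ ((⇑(T ^ a k)) '' translates T (C (φ k) i) (I (φ k)) ∩ B)) atTop
      (𝓝 (((N - n : ℕ) : ℝ≥0∞) / ((N : ℝ≥0∞) + 1) * μ (A ∩ B) +
        (1 / ((N : ℝ≥0∞) + 1)) * μ ((⇑(T ^ (p : ℤ))) '' A ∩ B))) by
    refine tendsto_measure_inter_congr
      (S' := fun k => (⇑(T ^ a k)) '' translates T (E (φ k)) (I (φ k))) (hsum.congr fun k => ?_)
      ((hlim.comp hφt).congr fun k => ?_)
    · rw [hT.translates_eq_biUnion, image_iUnion₂, iUnion₂_inter, measure_biUnion_finset]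
      · exact fun i hi i' hi' hne => (((disjoint_image_iff (T ^ a k).injective).2
          (hT.translates_column_disjoint _ hi hi' hne (hI _) (hI _))).mono
            inter_subset_left inter_subset_left)
      · exact fun i _ => (hT.measurableSet_zpow_image _ (hmeas _ _)).inter hB
    · rw [← image_symmDiff (T ^ a k).injective, hT.measure_zpow_image]
      · rfl
      · exact hA.symmDiff (hT.measurableSet_translates (hT.measE _) _)
  have hshift : μ (A ∩ (⇑(T ^ (-(p : ℤ)))) '' B) = μ ((⇑(T ^ (p : ℤ))) '' A ∩ B) := by
    rw [image_inter_eq_image_inter_neg,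
      hT.measure_zpow_image _ (hA.inter (hT.measurableSet_zpow_image _ hB))]
  have hterm : ∀ i ∈ Finset.Icc 1 (N + 1), Tendsto (fun k =>
      μ ((⇑(T ^ a k)) '' translates T (C (φ k) i) (I (φ k)) ∩ B)) atTop
      (𝓝 (if i ≤ n then 0 else if i ≤ N then μ (A ∩ B) / (N + 1) else
        μ ((⇑(T ^ (p : ℤ))) '' A ∩ B) / (N + 1))) := by
    intro i hi
    have hi' := Finset.mem_Icc.1 hi
    split_ifs with hin hiN
    · refine tendsto_of_tendsto_of_tendsto_of_le_of_le' tendsto_const_nhds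
        ((hT.tendsto_measure_diff_tower hB hBfin).comp hφt)
        (Eventually.of_forall fun _ => zero_le) ?_
      filter_upwards [hφt.eventually hT.eventually_mul_lt_spacers] with k hk
      exact measure_mono fun x hx => ⟨hx.2, disjoint_left.1
        (hT.zpow_image_column_disjoint_tower hk hnN hi'.1 hin (hI _)) hx.1⟩
    · have hmem : i - n ∈ Finset.Icc 1 (N + 1) := Finset.mem_Icc.2 (by omega)
      refine ((hT.tendsto_measure_translates_column_inter hA hB hAfin hI hlim hmem).comp
        hφt).congr fun k => ?_
      have hcol : (⇑(T ^ a k)) '' C (φ k) i = (⇑(T ^ (0 : ℤ))) '' C (φ k) (i - n) := by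
        refine hT.zpow_image_column _ hi hmem _ _ ?_
        obtain ⟨m, rfl⟩ := Nat.exists_eq_add_of_lt (not_le.1 hin)
        simp only [ha, columnLevel, if_neg (show n + m + 1 ≠ N + 1 by omega),
          if_neg (show n + m + 1 - n ≠ N + 1 by omega), show n + m + 1 - 1 = n + m by omega,
          show n + m + 1 - n - 1 = m by omega]
        push_cast
        ring
      rw [zpow_image_translates, hcol]
      simp
    · obtain rfl : i = N + 1 := by omega
      have hmem : N + 1 - n ∈ Finset.Icc 1 (N + 1) := Finset.mem_Icc.2 (by omega)
      rw [← hshift]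
      refine ((hT.tendsto_measure_translates_column_inter hA
        (hT.measurableSet_zpow_image _ hB) hAfin hI hlim hmem).comp hφt).congr fun k => ?_
      have hcol : (⇑(T ^ a k)) '' C (φ k) (N + 1) =
          (⇑(T ^ (p : ℤ))) '' C (φ k) (N + 1 - n) := by
        refine hT.zpow_image_column _ hi hmem _ _ ?_
        obtain ⟨m, rfl⟩ := Nat.exists_eq_add_of_le hnN
        simp only [ha, columnLevel, if_pos, if_neg (show n + m + 1 - n ≠ n + m + 1 by omega),
          show n + m + 1 - 1 = n + m by omega, show n + m + 1 - n - 1 = m by omega, hφ]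
        push_cast
        ring
      rw [zpow_image_translates, hcol, ← zpow_image_translates, image_inter_eq_image_inter_neg,
        hT.measure_zpow_image _ ((hmeas _ _).inter (hT.measurableSet_zpow_image _ hB))]
      rfl
  convert tendsto_finsetSum _ hterm using 2
  rw [Finset.sum_Icc_succ_top (by omega), if_neg (by omega), if_neg (by omega)]
  have hrest : ∀ i ∈ Finset.Icc 1 N, (if i ≤ n then 0 else if i ≤ N then μ (A ∩ B) / (N + 1) else
      μ ((⇑(T ^ (p : ℤ))) '' A ∩ B) / (N + 1)) =
      if ¬ i ≤ n then μ (A ∩ B) / (N + 1) else 0 := by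
    intro i hi
    rw [if_pos (Finset.mem_Icc.1 hi).2, ite_not]
  have hcard : ((Finset.Icc 1 N).filter fun i => ¬ i ≤ n) = Finset.Ioc n N := by
    ext i
    simp only [Finset.mem_filter, Finset.mem_Icc, Finset.mem_Ioc]
    omega
  rw [Finset.sum_congr rfl hrest, ← Finset.sum_filter, hcard, Finset.sum_const, Nat.card_Ioc,
    nsmul_eq_mul]
  simp only [div_eq_mul_inv, one_mul]
  ring
end

section
/- Let (X,μ) be a σ-finite Lebesgue space, T an invertible measure-preserving transformation of X, and 1 ≤ m < n integers. Let f ∈ L²(X,μ) be a cyclic vector for every nonzero power of the Koopman operator of T, i.e. for every p ≠ 0 the linear span of {f∘T^{pk} : k ∈ ℤ} is dense in L²(X,μ). Let C ⊆ L²(X×X, μ×μ) be a closed subspace containing the function f⊗f : (x,y) ↦ f(x)f(y) and invariant under the Koopman operators of T^m×T^n, of (T^m×T^n)^{-1}, of T^{n−m}×Id, and of (T^{n−m}×Id)^{-1}. Then C = L²(X×X, μ×μ). -/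
open MeasureTheory Filter Topology Set
open scoped ENNReal

section TensorProduct

variable {X Y : Type*} [MeasurableSpace X] [MeasurableSpace Y]
  {μ : Measure X} {ν : Measure Y}

theorem ae_prod_fst {P : X → Prop} (hP : ∀ᵐ x ∂μ, P x) : ∀ᵐ z ∂μ.prod ν, P z.1 :=
  Measure.quasiMeasurePreserving_fst.ae hP

theorem ae_prod_snd {P : Y → Prop} (hP : ∀ᵐ y ∂ν, P y) : ∀ᵐ z ∂μ.prod ν, P z.2 :=
  Measure.quasiMeasurePreserving_snd.ae hP

theorem setIntegral_eq_zero_of_forall_prod {E : Type*} [NormedAddCommGroup E] [NormedSpace ℝ E]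
    {u : X × Y → E} (hu : Integrable u (μ.prod ν))
    (h : ∀ s t, MeasurableSet s → MeasurableSet t → ∫ z in s ×ˢ t, u z ∂μ.prod ν = 0)
    {r : Set (X × Y)} (hr : MeasurableSet r) : ∫ z in r, u z ∂μ.prod ν = 0 := by
  induction r, hr using MeasurableSpace.induction_on_inter generateFrom_prod.symm
    isPiSystem_prod with
  | empty => simp
  | basic r hr =>
    obtain ⟨s, hs, t, ht, rfl⟩ := hr
    exact h s t hs ht
  | compl r hr ih =>
    have huniv := h univ univ .univ .univ
    rw [univ_prod_univ, setIntegral_univ] at huniv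
    simpa [ih, huniv] using integral_add_compl hr hu
  | iUnion r hd hr ih =>
    rw [integral_iUnion hr hd hu.integrableOn]
    simp [ih]

section SFinite

variable [SFinite ν]

theorem eLpNorm_fst_mul_snd {p : ℝ≥0∞} (hp0 : p ≠ 0) (hp : p ≠ ∞) {g : X → ℂ} {h : Y → ℂ}
    (hg : AEStronglyMeasurable g μ) (hh : AEStronglyMeasurable h ν) :
    eLpNorm (fun z : X × Y => g z.1 * h z.2) p (μ.prod ν) = eLpNorm g p μ * eLpNorm h p ν := by
  simp only [eLpNorm_eq_lintegral_rpow_enorm_toReal hp0 hp, enorm_mul,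
    ENNReal.mul_rpow_of_nonneg _ _ ENNReal.toReal_nonneg]
  rw [lintegral_prod_mul (hg.enorm.pow_const _) (hh.enorm.pow_const _),
    ENNReal.mul_rpow_of_nonneg _ _ (by positivity)]

theorem memLp_fst_mul_snd {p : ℝ≥0∞} (hp0 : p ≠ 0) (hp : p ≠ ∞) {g : X → ℂ} {h : Y → ℂ}
    (hg : MemLp g p μ) (hh : MemLp h p ν) :
    MemLp (fun z : X × Y => g z.1 * h z.2) p (μ.prod ν) :=
  ⟨hg.1.comp_fst.mul hh.1.comp_snd, by
    rw [eLpNorm_fst_mul_snd hp0 hp hg.1 hh.1]; exact ENNReal.mul_lt_top hg.2 hh.2⟩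

/-- The elementary tensor `(x, y) ↦ g x * h y` of two `L²` functions. -/
noncomputable def lpTensor (g : Lp ℂ 2 μ) (h : Lp ℂ 2 ν) : Lp ℂ 2 (μ.prod ν) :=
  (memLp_fst_mul_snd (by norm_num) (by norm_num) (Lp.memLp g) (Lp.memLp h)).toLp _

theorem coeFn_lpTensor (g : Lp ℂ 2 μ) (h : Lp ℂ 2 ν) :
    ∀ᵐ z ∂μ.prod ν, lpTensor g h z = g z.1 * h z.2 :=
  MemLp.coeFn_toLp _

theorem norm_lpTensor (g : Lp ℂ 2 μ) (h : Lp ℂ 2 ν) : ‖lpTensor g h‖ = ‖g‖ * ‖h‖ := by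
  rw [lpTensor, Lp.norm_toLp, eLpNorm_fst_mul_snd (by norm_num) (by norm_num)
    (Lp.aestronglyMeasurable g) (Lp.aestronglyMeasurable h), ENNReal.toReal_mul, Lp.norm_def,
    Lp.norm_def]

variable (μ ν) in
/-- The elementary tensor as a continuous bilinear map. -/
noncomputable def lpTensorL : Lp ℂ 2 μ →L[ℂ] Lp ℂ 2 ν →L[ℂ] Lp ℂ 2 (μ.prod ν) :=
  LinearMap.mkContinuous₂
    (LinearMap.mk₂ ℂ lpTensor
      (fun g g' h => Lp.ext <| by
        filter_upwards [coeFn_lpTensor (g + g') h, coeFn_lpTensor g h, coeFn_lpTensor g' h,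
          Lp.coeFn_add (lpTensor g h) (lpTensor g' h),
          ae_prod_fst (ν := ν) (Lp.coeFn_add g g')] with z h₁ h₂ h₃ h₄ h₅
        rw [h₁, h₄, Pi.add_apply, h₂, h₃, h₅, Pi.add_apply, add_mul])
      (fun c g h => Lp.ext <| by
        filter_upwards [coeFn_lpTensor (c • g) h, coeFn_lpTensor g h,
          Lp.coeFn_smul c (lpTensor g h),
          ae_prod_fst (ν := ν) (Lp.coeFn_smul c g)] with z h₁ h₂ h₃ h₄
        simp [h₁, h₂, h₃, h₄, mul_assoc])
      (fun g h h' => Lp.ext <| by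
        filter_upwards [coeFn_lpTensor g (h + h'), coeFn_lpTensor g h, coeFn_lpTensor g h',
          Lp.coeFn_add (lpTensor g h) (lpTensor g h'),
          ae_prod_snd (μ := μ) (Lp.coeFn_add h h')] with z h₁ h₂ h₃ h₄ h₅
        rw [h₁, h₄, Pi.add_apply, h₂, h₃, h₅, Pi.add_apply, mul_add])
      (fun c g h => Lp.ext <| by
        filter_upwards [coeFn_lpTensor g (c • h), coeFn_lpTensor g h,
          Lp.coeFn_smul c (lpTensor g h),
          ae_prod_snd (μ := μ) (Lp.coeFn_smul c h)] with z h₁ h₂ h₃ h₄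
        simp [h₁, h₂, h₃, h₄, mul_left_comm]))
    1 (fun g h => by simp [norm_lpTensor])

theorem lpTensor_indicatorConstLp_one {s : Set X} {t : Set Y} (hs : MeasurableSet s)
    (ht : MeasurableSet t) (hμs : μ s ≠ ∞) (hνt : ν t ≠ ∞) (hst : μ.prod ν (s ×ˢ t) ≠ ∞) :
    lpTensor (indicatorConstLp 2 hs hμs (1 : ℂ)) (indicatorConstLp 2 ht hνt (1 : ℂ)) =
      indicatorConstLp 2 (hs.prod ht) hst 1 := by
  apply Lp.ext
  filter_upwards [coeFn_lpTensor (indicatorConstLp 2 hs hμs (1 : ℂ))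
      (indicatorConstLp 2 ht hνt (1 : ℂ)),
    ae_prod_fst (ν := ν) (indicatorConstLp_coeFn (p := 2) (hs := hs) (hμs := hμs) (c := (1 : ℂ))),
    ae_prod_snd (μ := μ) (indicatorConstLp_coeFn (p := 2) (hs := ht) (hμs := hνt) (c := (1 : ℂ))),
    indicatorConstLp_coeFn (p := 2) (hs := hs.prod ht) (hμs := hst) (c := (1 : ℂ))]
    with z h₁ h₂ h₃ h₄
  rw [h₁, h₂, h₃, h₄]
  by_cases h1 : z.1 ∈ s <;> by_cases h2 : z.2 ∈ t <;> simp [indicator, h1, h2]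

theorem lpTensor_comp [SFinite μ] {S : X → X} {R : Y → Y} (hS : MeasurePreserving S μ μ)
    (hR : MeasurePreserving R ν ν) (g g' : Lp ℂ 2 μ) (h h' : Lp ℂ 2 ν)
    (hg : ∀ᵐ x ∂μ, g' x = g (S x)) (hh : ∀ᵐ y ∂ν, h' y = h (R y)) :
    ∀ᵐ z ∂μ.prod ν, lpTensor g' h' z = lpTensor g h (S z.1, R z.2) := by
  filter_upwards [coeFn_lpTensor g' h', (hS.prod hR).quasiMeasurePreserving.ae (coeFn_lpTensor g h),
    ae_prod_fst (ν := ν) hg, ae_prod_snd (μ := μ) hh] with z h₁ h₂ h₃ h₄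
  rw [h₁, h₃, h₄]
  exact h₂.symm

end SFinite

theorem Lp_eq_zero_of_forall_setIntegral_prod [SigmaFinite μ] [SigmaFinite ν]
    (u : Lp ℂ 2 (μ.prod ν))
    (h : ∀ s t, MeasurableSet s → MeasurableSet t → μ s ≠ ∞ → ν t ≠ ∞ →
      ∫ z in s ×ˢ t, u z ∂μ.prod ν = 0) : u = 0 := by
  rw [Lp.eq_zero_iff_ae_eq_zero]
  let B : ℕ → Set (X × Y) := fun i => spanningSets μ i ×ˢ spanningSets ν i
  have hB : ∀ i, ∀ᵐ z ∂(μ.prod ν).restrict (B i), u z = 0 := by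
    intro i
    have hBfin : μ.prod ν (B i) ≠ ∞ := by
      rw [Measure.prod_prod]
      exact (ENNReal.mul_lt_top (measure_spanningSets_lt_top μ i)
        (measure_spanningSets_lt_top ν i)).ne
    have hint : IntegrableOn u (B i) (μ.prod ν) :=
      integrableOn_Lp_of_measure_ne_top u (by norm_num) hBfin
    rw [IntegrableOn, ← Measure.prod_restrict] at hint
    rw [← Measure.prod_restrict]
    refine hint.ae_eq_zero_of_forall_setIntegral_eq_zero fun r hr _ =>
      setIntegral_eq_zero_of_forall_prod hint (fun s t hs ht => ?_) hr
    rw [Measure.prod_restrict, Measure.restrict_restrict (hs.prod ht), prod_inter_prod]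
    exact h _ _ (hs.inter (measurableSet_spanningSets μ i))
      (ht.inter (measurableSet_spanningSets ν i))
      (measure_ne_top_of_subset inter_subset_right (measure_spanningSets_lt_top μ i).ne)
      (measure_ne_top_of_subset inter_subset_right (measure_spanningSets_lt_top ν i).ne)
  have hcover : ⋃ i, B i = univ := by
    rw [iUnion_prod_of_monotone (monotone_spanningSets μ) (monotone_spanningSets ν),
      iUnion_spanningSets, iUnion_spanningSets, univ_prod_univ]
  have := (ae_restrict_iUnion_iff B (fun z => u z = 0)).2 hB
  rwa [hcover, Measure.restrict_univ] at this

/-- Elementary tensors are total in `L²` of a product. -/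
theorem eq_top_of_forall_lpTensor_mem [SigmaFinite μ] [SigmaFinite ν]
    {C : Submodule ℂ (Lp ℂ 2 (μ.prod ν))}
    (hC : IsClosed (C : Set (Lp ℂ 2 (μ.prod ν)))) (h : ∀ g h, lpTensor g h ∈ C) : C = ⊤ := by
  have : CompleteSpace C := hC.completeSpace_coe
  rw [← Submodule.orthogonal_eq_bot_iff, Submodule.eq_bot_iff]
  intro u hu
  refine Lp_eq_zero_of_forall_setIntegral_prod u fun s t hs ht hμs hνt => ?_
  have hst : μ.prod ν (s ×ˢ t) ≠ ∞ := by
    rw [Measure.prod_prod]; exact ENNReal.mul_ne_top hμs hνt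
  rw [← L2.inner_indicatorConstLp_one (𝕜 := ℂ) (hs.prod ht) hst,
    ← lpTensor_indicatorConstLp_one hs ht hμs hνt hst]
  exact hu _ (h _ _)

end TensorProduct

theorem Submodule.apply_mem_of_dense_span {𝕜 E G : Type*} [Semiring 𝕜] [AddCommMonoid E]
    [AddCommMonoid G] [Module 𝕜 E] [Module 𝕜 G] [TopologicalSpace E] [TopologicalSpace G]
    {C : Submodule 𝕜 G} (hC : IsClosed (C : Set G)) {S : Set E}
    (hS : Dense (Submodule.span 𝕜 S : Set E)) (L : E →L[𝕜] G) (h : ∀ v ∈ S, L v ∈ C) (v : E) :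
    L v ∈ C := by
  have hle : Submodule.span 𝕜 S ≤ C.comap L.toLinearMap := Submodule.span_le.2 h
  exact (hC.preimage L.continuous).closure_subset_iff.2 hle (hS v)

theorem MeasureTheory.MeasurePreserving.perm_zpow {X : Type*} [MeasurableSpace X] {μ : Measure X}
    {T : Equiv.Perm X} (hT : MeasurePreserving T μ μ) (hT' : Measurable T.symm) (k : ℤ) :
    MeasurePreserving (T ^ k : Equiv.Perm X) μ μ := by
  have hinv : MeasurePreserving (T⁻¹ : Equiv.Perm X) μ μ :=
    hT.symm (⟨T, hT.measurable, hT'⟩ : X ≃ᵐ X)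
  induction k using Int.induction_on with
  | zero => exact .id μ
  | succ k ih => rw [zpow_add_one]; exact ih.comp hT
  | pred k ih => rw [zpow_sub_one]; exact ih.comp hinv

theorem exists_lp_comp {X : Type*} [MeasurableSpace X] {μ : Measure X} {S : X → X}
    (hS : MeasurePreserving S μ μ) (g : Lp ℂ 2 μ) :
    ∃ g' : Lp ℂ 2 μ, ∀ᵐ x ∂μ, g' x = g (S x) :=
  ⟨Lp.compMeasurePreserving S hS g, Lp.coeFn_compMeasurePreserving g hS⟩

/-- Cyclicity argument from the proof of Theorem 2. Let `f ∈ L²(X,μ)` be a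
cyclic vector for every nonzero power of the Koopman operator of `T`, and let
`C` be a closed subspace of `L²(X×X, μ×μ)` containing `f⊗f` and invariant under
the Koopman operators of `T^m × T^n`, `(T^m × T^n)⁻¹`, `T^{n-m} × Id` and
`(T^{n-m} × Id)⁻¹` (with `1 ≤ m < n`). Then `C = L²(X×X, μ×μ)`. -/
theorem cyclic_space_of_product_is_everything
    {X : Type*} [MeasurableSpace X] [StandardBorelSpace X]
    (μ : Measure X) [SigmaFinite μ]
    (T : Equiv.Perm X) (hTmeas : Measurable (⇑T)) (hTmeas' : Measurable (⇑T.symm))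
    (hT : MeasurePreserving ⇑T μ μ)
    (m n : ℕ) (hm : 1 ≤ m) (hmn : m < n)
    (f : Lp ℂ 2 μ)
    (hcyc : ∀ p : ℤ, p ≠ 0 → Dense
      ((Submodule.span ℂ
        {g : Lp ℂ 2 μ | ∃ k : ℤ, ∀ᵐ x ∂μ, g x = f ((T ^ (p * k)) x)} :
        Submodule ℂ (Lp ℂ 2 μ)) : Set (Lp ℂ 2 μ)))
    (C : Submodule ℂ (Lp ℂ 2 (μ.prod μ)))
    (hCclosed : IsClosed (C : Set (Lp ℂ 2 (μ.prod μ))))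
    (F : Lp ℂ 2 (μ.prod μ))
    (hF : ∀ᵐ z ∂(μ.prod μ), F z = f z.1 * f z.2)
    (hFC : F ∈ C)
    (hinv₁ : ∀ g ∈ C, ∀ g' : Lp ℂ 2 (μ.prod μ),
      (∀ᵐ z ∂(μ.prod μ), g' z = g ((T ^ (m : ℤ)) z.1, (T ^ (n : ℤ)) z.2)) → g' ∈ C)
    (hinv₂ : ∀ g ∈ C, ∀ g' : Lp ℂ 2 (μ.prod μ),
      (∀ᵐ z ∂(μ.prod μ), g' z = g ((T ^ (-(m : ℤ))) z.1, (T ^ (-(n : ℤ))) z.2)) → g' ∈ C)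
    (hinv₃ : ∀ g ∈ C, ∀ g' : Lp ℂ 2 (μ.prod μ),
      (∀ᵐ z ∂(μ.prod μ), g' z = g ((T ^ ((n : ℤ) - (m : ℤ))) z.1, z.2)) → g' ∈ C)
    (hinv₄ : ∀ g ∈ C, ∀ g' : Lp ℂ 2 (μ.prod μ),
      (∀ᵐ z ∂(μ.prod μ), g' z = g ((T ^ ((m : ℤ) - (n : ℤ))) z.1, z.2)) → g' ∈ C) :
    C = ⊤ := by
  have hpow : ∀ k : ℤ, MeasurePreserving (T ^ k : Equiv.Perm X) μ μ := hT.perm_zpow hTmeas'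
  have hcomp : ∀ {g g' : Lp ℂ 2 μ} {a b c : ℤ}, a = b + c →
      (∀ᵐ x ∂μ, g' x = f ((T ^ a) x)) → (∀ᵐ x ∂μ, g x = f ((T ^ b) x)) →
      ∀ᵐ x ∂μ, g' x = g ((T ^ c) x) := by
    rintro g g' a b c rfl hg' hg
    filter_upwards [hg', (hpow c).quasiMeasurePreserving.ae hg] with x h₁ h₂
    rw [h₁, h₂, zpow_add, Equiv.Perm.mul_apply]
  have hfst : ∀ (k : ℤ) (u : Lp ℂ 2 μ),
      (∀ᵐ x ∂μ, u x = f ((T ^ (((n : ℤ) - m) * k)) x)) → lpTensor u f ∈ C := by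
    intro k
    induction k using Int.induction_on with
    | zero =>
      intro u hu
      convert! hFC
      apply Lp.ext
      filter_upwards [coeFn_lpTensor u f, hF, ae_prod_fst (ν := μ) hu] with z h₁ h₂ h₃
      rw [h₁, h₂, h₃]
      simp
    | succ k ih =>
      intro u hu
      obtain ⟨w, hw⟩ := exists_lp_comp (hpow (((n : ℤ) - m) * k)) f
      exact hinv₃ _ (ih w hw) _ <| lpTensor_comp (hpow _) (.id μ)
        w u f f (hcomp (by ring) hu hw) (by simp)
    | pred k ih =>
      intro u hu
      obtain ⟨w, hw⟩ := exists_lp_comp (hpow (((n : ℤ) - m) * (-k))) f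
      exact hinv₄ _ (ih w hw) _ <| lpTensor_comp (hpow _) (.id μ)
        w u f f (hcomp (by ring) hu hw) (by simp)
  have hleft : ∀ g : Lp ℂ 2 μ, lpTensor g f ∈ C :=
    Submodule.apply_mem_of_dense_span hCclosed (hcyc ((n : ℤ) - m) (by lia))
      ((lpTensorL μ μ).flip f) fun u ⟨k, hu⟩ => hfst k u hu
  have hsnd : ∀ (k : ℤ) (g v : Lp ℂ 2 μ),
      (∀ᵐ x ∂μ, v x = f ((T ^ ((n : ℤ) * k)) x)) → lpTensor g v ∈ C := by
    have hshift : ∀ (g : Lp ℂ 2 μ) (a : ℤ), ∃ g' : Lp ℂ 2 μ, ∀ᵐ x ∂μ, g x = g' ((T ^ a) x) := by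
      intro g a
      obtain ⟨g', hg'⟩ := exists_lp_comp (hpow (-a)) g
      refine ⟨g', ?_⟩
      filter_upwards [(hpow a).quasiMeasurePreserving.ae hg'] with x hx
      rw [hx, ← Equiv.Perm.mul_apply, ← zpow_add]
      simp
    intro k
    induction k using Int.induction_on with
    | zero =>
      intro g v hv
      convert! hleft g
      exact Lp.ext (by simpa using! hv)
    | succ k ih =>
      intro g v hv
      obtain ⟨w, hw⟩ := exists_lp_comp (hpow ((n : ℤ) * k)) f
      obtain ⟨g', hg'⟩ := hshift g m
      exact hinv₁ _ (ih g' w hw) _ <|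
        lpTensor_comp (hpow _) (hpow _) g' g w v hg' (hcomp (by ring) hv hw)
    | pred k ih =>
      intro g v hv
      obtain ⟨w, hw⟩ := exists_lp_comp (hpow ((n : ℤ) * (-k))) f
      obtain ⟨g', hg'⟩ := hshift g (-m)
      exact hinv₂ _ (ih g' w hw) _ <|
        lpTensor_comp (hpow _) (hpow _) g' g w v hg' (hcomp (by ring) hv hw)
  exact eq_top_of_forall_lpTensor_mem hCclosed fun g =>
    Submodule.apply_mem_of_dense_span hCclosed (hcyc n (by lia)) (lpTensorL μ μ g)
      fun v ⟨k, hv⟩ => hsnd k g v hv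
end

section
/- Let T be the two-column rank-one cutting-and-stacking transformation with no spacers over the first column and s_j(2) spacers over the second, s_j(2)/h_j → ∞. Let A and B be finite unions of levels T^iE_{j₀} of the stage-j₀ tower, and let n_k → +∞ be a sequence of integers with liminf_k μ(T^{n_k}A ∩ B) > 0. Then for all sufficiently large k there exists a stage j(k) such that h_{j(k)} − 2h_{j(k)−1} < n_k < h_{j(k)} + 2h_{j(k)−1}. -/
open MeasureTheory Filter Topology Set
open scoped ENNReal symmDiff

namespace TwoColumnCutStack

variable {X : Type*} [MeasurableSpace X] {μ : Measure X} {T : Equiv.Perm X} {E : ℕ → Set X}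
  {h s : ℕ → ℕ}

theorem exists_mem_succ (hT : TwoColumnCutStack μ T E h s) {m : ℕ} {x : X} (hx : x ∈ E m) :
    ∃ x' ∈ E (m + 1), ∃ a : ℤ, (a = 0 ∨ a = h m) ∧ (T ^ a) x' = x := by
  rw [hT.cut m] at hx
  rcases hx with hx | ⟨x', hx', rfl⟩
  · exact ⟨x, hx, 0, Or.inl rfl, rfl⟩
  · exact ⟨x', hx', h m, Or.inr rfl, rfl⟩

/-- A point of the base of a tower cannot return to it in less than the height of the tower. -/
theorem eq_zero_of_mem_base (hT : TwoColumnCutStack μ T E h s) {m : ℕ} {x : X} {r : ℤ}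
    (hx : x ∈ E m) (hy : (T ^ r) x ∈ E m) (hr : |r| < h m) : r = 0 := by
  have no_return : ∀ i : ℕ, i < h m → i ≠ 0 → ∀ z ∈ E m, (T ^ (i : ℤ)) z ∉ E m := by
    intro i hi hi0 z hz hz'
    refine Set.disjoint_left.mp (hT.disjLevels m i 0 hi (hT.hpos m) hi0) ⟨z, hz, rfl⟩ ?_
    exact ⟨_, hz', by simp⟩
  obtain ⟨i, rfl | rfl⟩ := r.eq_nat_or_neg
  · by_contra hi
    exact no_return i (by simpa using hr) (by simpa using hi) x hx hy
  · by_contra hi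
    refine no_return i (by simpa using hr) (by simpa using hi) _ hy ?_
    rwa [← Equiv.Perm.mul_apply, ← zpow_add, add_neg_cancel, zpow_zero]

/-- Passing from the stage-`j` tower to the stage-`(j + t)` tower, the displacement `d` between
two points of `E j` is corrected by an integer `w` which is a signed sum of heights. -/
theorem exists_displacement (hT : TwoColumnCutStack μ T E h s) {j : ℕ} {e : X} {d : ℤ}
    (he : e ∈ E j) (he' : (T ^ d) e ∈ E j) (t : ℕ) :
    ∃ w : ℤ, ∃ x ∈ E (j + t), (T ^ (d - w)) x ∈ E (j + t) ∧
      |w| ≤ h (j + t) - h j ∧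
      (∀ p, t = p + 1 → |w| ≤ 2 * h (j + p) - h j) ∧
      (w ≤ h j ∨ ∃ p, |w - h (j + p + 1)| ≤ 2 * h (j + p) - h j) := by
  induction t with
  | zero => exact ⟨0, e, he, by simpa using he', by simp⟩
  | succ t ih =>
    obtain ⟨w, x, hx, hy, hw, hwp, hwq⟩ := ih
    obtain ⟨x', hx', a, ha, hax⟩ := hT.exists_mem_succ hx
    obtain ⟨y', hy', b, hb, hby⟩ := hT.exists_mem_succ hy
    have hh := hT.height (j + t)
    have key : |w + b - a| ≤ 2 * h (j + t) - h j := by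
      rw [abs_le] at hw ⊢
      omega
    refine ⟨w + b - a, x', hx', ?_, ?_, ?_, ?_⟩
    · have : (T ^ (d - (w + b - a))) x' = y' := by
        apply (T ^ b).injective
        rw [hby, ← hax, ← Equiv.Perm.mul_apply, ← Equiv.Perm.mul_apply, ← zpow_add, ← zpow_add]
        congr 2
        ring
      rw [this]
      exact hy'
    · rw [← add_assoc, hh]
      push_cast
      omega
    · rintro p hp
      obtain rfl : t = p := by omega
      exact key
    · rcases ha with rfl | rfl <;> rcases hb with rfl | rfl
      · simpa using hwq
      · cases t with
        | zero =>
          left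
          rw [abs_le] at hw
          simp only [add_zero] at hw ⊢
          omega
        | succ p =>
          refine Or.inr ⟨p, ?_⟩
          rw [← add_assoc]
          simpa using hwp p rfl
      · left
        rw [abs_le] at hw
        omega
      · simpa using hwq

/-- A displacement between two points of `E j` exceeding `h j` is close to a height. -/
theorem exists_near_height (hT : TwoColumnCutStack μ T E h s) {j : ℕ} {e : X} {d : ℤ}
    (he : e ∈ E j) (he' : (T ^ d) e ∈ E j) (hd : (h j : ℤ) < d) :
    ∃ p, |d - h (j + p + 1)| ≤ 2 * h (j + p) - h j := by
  obtain ⟨m, hm, hjm⟩ := ((hT.spacerGrowth.eventually_gt_atTop (d : ℝ)).and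
    (eventually_ge_atTop j)).exists
  obtain ⟨t, rfl⟩ := Nat.exists_eq_add_of_le hjm
  have hs : d < s (j + t) := by
    have hpos : (1 : ℝ) ≤ h (j + t) := by exact_mod_cast hT.hpos (j + t)
    have := hm.trans_le (div_le_self (Nat.cast_nonneg _) hpos)
    exact_mod_cast this
  obtain ⟨w, x, hx, hy, -, hwp, hwq⟩ := hT.exists_displacement he he' (t + 1)
  have hw := hwp t rfl
  have hh := hT.height (j + t)
  have hpos := hT.hpos j
  have hdw : d - w = 0 := by
    refine hT.eq_zero_of_mem_base hx hy ?_
    rw [← add_assoc, hh]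
    rw [abs_le] at hw
    rw [abs_lt]
    push_cast
    omega
  obtain rfl : d = w := by omega
  exact hwq.resolve_left (by omega)

end TwoColumnCutStack

/-- Condition (3) in the proof of Assertion 1: if `A` and `B` are unions of
levels of the stage-`j₀` tower of the two-column construction and
`liminf_k μ(T^{n_k}A ∩ B) > 0` along a sequence `n_k → +∞`, then for all large
`k` the exponent `n_k` localizes near some height:
`h_{j(k)} - 2h_{j(k)-1} < n_k < h_{j(k)} + 2h_{j(k)-1}`. -/
theorem positive_liminf_localizes_near_heights
    {X : Type*} [MeasurableSpace X] (μ : Measure X) [SigmaFinite μ]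
    (T : Equiv.Perm X) (E : ℕ → Set X) (h : ℕ → ℕ) (s : ℕ → ℕ)
    (hT : TwoColumnCutStack μ T E h s)
    (j₀ : ℕ) (A B : Set X)
    (I I' : Finset ℕ) (hI : ∀ i ∈ I, i < h j₀) (hI' : ∀ i ∈ I', i < h j₀)
    (hA : A = ⋃ i ∈ I, (⇑(T ^ (i : ℤ))) '' E j₀)
    (hB : B = ⋃ i ∈ I', (⇑(T ^ (i : ℤ))) '' E j₀)
    (n : ℕ → ℤ) (hntop : Tendsto n atTop atTop)
    (hliminf : 0 < Filter.liminf (fun k => μ ((⇑(T ^ n k)) '' A ∩ B)) atTop) :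
    ∀ᶠ k in atTop, ∃ j : ℕ, 1 ≤ j ∧
      (h j : ℤ) - 2 * (h (j - 1) : ℤ) < n k ∧ n k < (h j : ℤ) + 2 * (h (j - 1) : ℤ) := by
  have hpos : ∀ᶠ k in atTop, 0 < μ ((⇑(T ^ n k)) '' A ∩ B) := eventually_lt_of_lt_liminf hliminf
  filter_upwards [hpos, hntop.eventually_gt_atTop (2 * h j₀ : ℤ)] with k hk hnk
  obtain ⟨y, ⟨x, hxA, hxy⟩, hyB⟩ := nonempty_of_measure_ne_zero hk.ne'
  rw [hA] at hxA
  rw [hB] at hyB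
  simp only [mem_iUnion] at hxA hyB
  obtain ⟨a, ha, e, he, rfl⟩ := hxA
  obtain ⟨b, hb, e', he', rfl⟩ := hyB
  have ha' := hI a ha
  have hb' := hI' b hb
  have hret : (T ^ (n k + a - b)) e = e' := by
    apply (T ^ (b : ℤ)).injective
    rw [← hxy, ← Equiv.Perm.mul_apply, ← Equiv.Perm.mul_apply, ← zpow_add, ← zpow_add]
    congr 2
    ring
  obtain ⟨p, hp⟩ := hT.exists_near_height he (hret ▸ he') (by omega)
  rw [abs_le] at hp
  refine ⟨j₀ + p + 1, by omega, ?_, ?_⟩ <;> rw [Nat.add_sub_cancel] <;> omega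
end
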